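/- arXiv:2302.09060 — 3 statements merged into one kernel-verified Lean document; each statement's English description precedes it below -/
import Mathlib

section
/- There exists a constant C > 0 such that for every r ∈ [0, 1/2) there exist a natural number n with n ≤ C·(1/2 − r)^{−4/5}, unit vectors n₁,…,n_n in ℝ³, and weights α₁,…,α_n ≥ 0 with Σᵢ αᵢ = 1, such that for every unit vector c ∈ ℝ³ one has Σᵢ αᵢ·|⟨nᵢ, c⟩| ≥ r. (Upper bound N(r) ≤ C(1/2 − r)^{−4/5} on the compatibility complexity: the family of noisy spin measurements of noise parameter r can be simulated by a parent measurement with O((1/2 − r)^{−4/5}) outcomes.) -/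
open scoped RealInnerProductSpace


/-- sign of a Boolean -/
noncomputable def sgnB (b : Bool) : ℝ := if b then 1 else -1

lemma mgf_bound {I : Type*} [Fintype I] [DecidableEq I] (a : I → ℝ) (t : ℝ) :
    ∑ ε : I → Bool, Real.exp (t * ∑ i, a i * sgnB (ε i))
      ≤ 2 ^ Fintype.card I * Real.exp (t ^ 2 * (∑ i, a i ^ 2) / 2) := by
  have h1 : ∀ ε : I → Bool, Real.exp (t * ∑ i, a i * sgnB (ε i))
      = ∏ i, Real.exp (t * (a i * sgnB (ε i))) := by
    intro ε
    rw [Finset.mul_sum, Real.exp_sum]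
  simp_rw [h1]
  have h2 := Finset.prod_univ_sum (fun _ : I => (Finset.univ : Finset Bool))
    (fun i b => Real.exp (t * (a i * sgnB b)))
  rw [Fintype.piFinset_univ] at h2
  rw [← h2]
  have h3 : ∀ i, ∑ b : Bool, Real.exp (t * (a i * sgnB b)) ≤ 2 * Real.exp (t ^ 2 * a i ^ 2 / 2) := by
    intro i
    have := Real.cosh_le_exp_half_sq (t * a i)
    rw [Real.cosh_eq] at this
    simp only [Fintype.sum_bool, sgnB]
    simp only [if_true, Bool.false_eq_true, if_false]
    have e1 : (t * a i) ^ 2 / 2 = t ^ 2 * a i ^ 2 / 2 := by ring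
    rw [e1] at this
    have e2 : t * (a i * 1) = t * a i := by ring
    have e3 : t * (a i * -1) = -(t * a i) := by ring
    rw [e2, e3]
    linarith
  calc _ ≤ ∏ i, (2 * Real.exp (t ^ 2 * a i ^ 2 / 2)) :=
        Finset.prod_le_prod (fun i _ => Finset.sum_nonneg (fun b _ => (Real.exp_pos _).le))
          (fun i _ => h3 i)
    _ = _ := by
        rw [Finset.prod_mul_distrib, ← Real.exp_sum, Finset.prod_const, Finset.card_univ,
          Finset.mul_sum, Finset.sum_div]

/-- code length of the integer `b` at parameter `l` -/
noncomputable def codeCost (l : ℝ) (b : ℤ) : ℝ :=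
  if b = 0 then 2 * Real.exp (-l ^ 2 / 2) else 1 + l ^ 2 / 2 + (b.natAbs : ℝ)

lemma codeCost_nonneg (l : ℝ) (b : ℤ) : 0 ≤ codeCost l b := by
  unfold codeCost
  split_ifs
  · positivity
  · positivity

lemma kraft (l : ℝ) (hl : 2 ≤ l) (S : Finset ℤ) :
    ∑ b ∈ S, Real.exp (-codeCost l b) ≤ 1 := by
  set q := Real.exp (-l ^ 2 / 2) with hq
  have hq0 : 0 < q := Real.exp_pos _
  have he1 : Real.exp (-1) ≤ 1 / 2 := by
    rw [Real.exp_neg, one_div]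
    apply inv_anti₀ (by norm_num)
    linarith [Real.add_one_le_exp 1]
  have hq1 : q ≤ 1 / 2 := by
    refine le_trans (Real.exp_le_exp.mpr ?_) he1
    nlinarith
  let g : ℤ → ℝ := fun b => if b = 0 then 1 - q else (q / 2) * (1 / 2) ^ b.natAbs
  have hg : ∀ b, Real.exp (-codeCost l b) ≤ g b := by
    intro b
    simp only [g, codeCost]
    split_ifs with h
    · have h1 : Real.exp (-(2 * q)) ≤ 1 / (1 + 2 * q) := by
        rw [Real.exp_neg, one_div]
        apply inv_anti₀ (by positivity)
        linarith [Real.add_one_le_exp (2 * q)]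
      refine h1.trans ?_
      rw [div_le_iff₀ (by positivity)]
      nlinarith
    · have : -(1 + l ^ 2 / 2 + (b.natAbs : ℝ)) = -1 + (-l ^ 2 / 2) + b.natAbs * (-1) := by ring
      rw [this, Real.exp_add, Real.exp_add, Real.exp_nat_mul]
      have h2 : Real.exp (-1) ^ b.natAbs ≤ (1 / 2) ^ b.natAbs :=
        pow_le_pow_left₀ (Real.exp_pos _).le he1 _
      have h3 : Real.exp (-1) * q ≤ q / 2 := by nlinarith
      exact mul_le_mul h3 h2 (by positivity) (by positivity)
  have hgeo : HasSum (fun n : ℕ => (q / 2) * (1 / 2 : ℝ) ^ (n + 1)) (q / 2) := by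
    have h9 := (hasSum_geometric_two).mul_left (q / 2 * (1 / 2))
    have e1 : (fun n : ℕ => (q / 2) * (1 / 2 : ℝ) ^ (n + 1))
        = fun n : ℕ => q / 2 * (1 / 2) * (1 / 2 : ℝ) ^ n := by
      ext n; rw [pow_succ]; ring
    have e2 : q / 2 * (1 / 2) * 2 = q / 2 := by ring
    rw [e1]
    rw [e2] at h9
    exact h9
  have hs1 : HasSum (fun n : ℕ => g n) (1 - q + q / 2) := by
    have h0 : HasSum (fun n : ℕ => g ((n + 1 : ℕ) : ℤ)) (q / 2) := by
      have e1 : (fun n : ℕ => g ((n + 1 : ℕ) : ℤ)) = fun n : ℕ => (q / 2) * (1 / 2 : ℝ) ^ (n + 1) := by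
        ext n
        simp only [g]
        rw [if_neg (by omega), Int.natAbs_natCast]
      rw [e1]
      exact hgeo
    have := (hasSum_nat_add_iff (f := fun n : ℕ => g n) 1).mp h0
    have e3 : q / 2 + ∑ i ∈ Finset.range 1, g (i : ℤ) = 1 - q + q / 2 := by
      rw [Finset.sum_range_one]
      have : g ((0 : ℕ) : ℤ) = 1 - q := by simp only [g]; exact if_pos rfl
      rw [this]; ring
    rw [← e3]
    exact this
  have hs2 : HasSum (fun n : ℕ => g (-((n : ℤ) + 1))) (q / 2) := by
    have e1 : (fun n : ℕ => g (-((n : ℤ) + 1))) = fun n : ℕ => (q / 2) * (1 / 2 : ℝ) ^ (n + 1) := by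
      ext n
      have h8 : (-((n : ℤ) + 1)).natAbs = n + 1 := by omega
      simp only [g]
      rw [if_neg (by omega), h8]
    rw [e1]
    exact hgeo
  have hs := HasSum.of_nat_of_neg_add_one hs1 hs2
  have hgn : ∀ b, 0 ≤ g b := fun b => le_trans (Real.exp_pos _).le (hg b)
  calc _ ≤ ∑ b ∈ S, g b := Finset.sum_le_sum (fun b _ => hg b)
    _ ≤ 1 - q + q / 2 + q / 2 := sum_le_hasSum S (fun b _ => hgn b) hs
    _ = 1 := by ring

lemma cost_pointwise (l s L : ℝ) (hl : 2 ≤ l) (hs : 0 < s) :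
    codeCost l (round (L / (2 * (l * s)))) ≤ 2 * Real.exp (-l ^ 2 / 2)
      + (2 + l ^ 2 / 2) * (Real.exp (-l ^ 2) * (Real.exp ((l / s) * L) + Real.exp ((-(l / s)) * L))) := by
  unfold codeCost
  split_ifs with h
  · have : 0 ≤ (2 + l ^ 2 / 2) * (Real.exp (-l ^ 2) * (Real.exp ((l / s) * L) + Real.exp ((-(l / s)) * L))) := by positivity
    linarith
  · set y := L / (2 * (l * s)) with hy
    set b := round y with hb
    have hb1 : (1 : ℝ) ≤ (b.natAbs : ℝ) := by
      have : 1 ≤ b.natAbs := by omega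
      exact_mod_cast this
    have hr := abs_sub_round y
    have hbabs : (b.natAbs : ℝ) = |(b : ℝ)| := by
      rw [Nat.cast_natAbs]; simp
    have h1 : (b.natAbs : ℝ) ≤ |y| + 1 / 2 := by
      rw [hbabs]
      have : |(b : ℝ)| ≤ |y| + |y - b| := by
        have := abs_sub_abs_le_abs_sub (b : ℝ) y
        rw [abs_sub_comm] at this
        linarith
      linarith
    set X := |L| / s with hX
    have hyX : |y| = X / (2 * l) := by
      rw [hy, hX, abs_div, abs_of_pos (by positivity : 0 < 2 * (l * s))]
      field_simp
    have hl0 : 0 < l := by linarith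
    have hXl : l ≤ X := by
      have : 1 / 2 ≤ X / (2 * l) := by linarith
      rw [le_div_iff₀ (by positivity)] at this
      linarith
    have hbX : (b.natAbs : ℝ) ≤ X / l := by
      have : X / (2 * l) = X / l / 2 := by field_simp
      have h2 : 1 ≤ X / l := by rw [le_div_iff₀ hl0]; linarith
      linarith
    have hE : X / l ≤ Real.exp (l * X - l ^ 2) := by
      have := Real.add_one_le_exp (l * X - l ^ 2)
      refine le_trans ?_ this
      rw [div_le_iff₀ hl0]
      nlinarith [mul_nonneg (sub_nonneg.2 hXl) (sub_nonneg.2 hl), mul_nonneg (mul_nonneg (sub_nonneg.2 hXl) (sub_nonneg.2 hl)) hl0.le]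
    have hE1 : 1 ≤ Real.exp (l * X - l ^ 2) := by
      apply Real.one_le_exp; nlinarith
    have hE2 : Real.exp (l * X - l ^ 2) ≤
        Real.exp (-l ^ 2) * (Real.exp ((l / s) * L) + Real.exp ((-(l / s)) * L)) := by
      have : l * X - l ^ 2 = -l ^ 2 + l * X := by ring
      rw [this, Real.exp_add]
      apply mul_le_mul_of_nonneg_left _ (Real.exp_pos _).le
      rcases abs_cases L with ⟨hL, _⟩ | ⟨hL, _⟩
      · have : l * X = (l / s) * L := by rw [hX, hL]; field_simp
        rw [this]; linarith [Real.exp_pos ((-(l / s)) * L)]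
      · have : l * X = (-(l / s)) * L := by rw [hX, hL]; field_simp
        rw [this]; linarith [Real.exp_pos ((l / s) * L)]
    have hq : 0 < Real.exp (-l ^ 2 / 2) := Real.exp_pos _
    have : 1 + l ^ 2 / 2 + (b.natAbs : ℝ) ≤ (2 + l ^ 2 / 2) * Real.exp (l * X - l ^ 2) := by
      nlinarith [mul_nonneg (sq_nonneg l) (sub_nonneg.2 hE1)]
    have h4 : (2 + l ^ 2 / 2) * Real.exp (l * X - l ^ 2) ≤ (2 + l ^ 2 / 2) * (Real.exp (-l ^ 2) * (Real.exp ((l / s) * L) + Real.exp ((-(l / s)) * L))) :=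
      mul_le_mul_of_nonneg_left hE2 (by positivity)
    linarith

lemma cost_mean {I : Type*} [Fintype I] [DecidableEq I] (a : I → ℝ) (l s : ℝ) (hl : 2 ≤ l)
    (hs : 0 < s) (hvar : ∑ i, a i ^ 2 ≤ s ^ 2) :
    ∑ ε : I → Bool, codeCost l (round ((∑ i, a i * sgnB (ε i)) / (2 * (l * s))))
      ≤ 2 ^ Fintype.card I * (6 * Real.exp (-l ^ 2 / 4)) := by
  have hmg : ∀ t : ℝ, t ^ 2 = (l / s) ^ 2 → ∑ ε : I → Bool, Real.exp (t * ∑ i, a i * sgnB (ε i))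
      ≤ 2 ^ Fintype.card I * Real.exp (l ^ 2 / 2) := by
    intro t ht
    refine (mgf_bound a t).trans ?_
    apply mul_le_mul_of_nonneg_left _ (by positivity)
    apply Real.exp_le_exp.mpr
    rw [ht, div_pow]
    have : l ^ 2 / s ^ 2 * (∑ i, a i ^ 2) ≤ l ^ 2 := by
      rw [div_mul_eq_mul_div, div_le_iff₀ (by positivity)]
      exact mul_le_mul_of_nonneg_left hvar (by positivity)
    linarith
  have h1 := hmg (l / s) rfl
  have h2 := hmg (-(l / s)) (by ring)
  calc _ ≤ ∑ ε : I → Bool, (2 * Real.exp (-l ^ 2 / 2)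
      + (2 + l ^ 2 / 2) * (Real.exp (-l ^ 2) * (Real.exp ((l / s) * ∑ i, a i * sgnB (ε i)) + Real.exp ((-(l / s)) * ∑ i, a i * sgnB (ε i))))) :=
        Finset.sum_le_sum (fun ε _ => cost_pointwise l s _ hl hs)
    _ = 2 ^ Fintype.card I * (2 * Real.exp (-l ^ 2 / 2)) + (2 + l ^ 2 / 2) * (Real.exp (-l ^ 2) *
        (∑ ε : I → Bool, Real.exp ((l / s) * ∑ i, a i * sgnB (ε i)) + ∑ ε : I → Bool, Real.exp ((-(l / s)) * ∑ i, a i * sgnB (ε i)))) := by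
        rw [Finset.sum_add_distrib, Finset.sum_const, ← Finset.mul_sum, ← Finset.mul_sum, Finset.sum_add_distrib]
        simp
    _ ≤ 2 ^ Fintype.card I * (2 * Real.exp (-l ^ 2 / 2)) + (2 + l ^ 2 / 2) * (Real.exp (-l ^ 2) *
        (2 ^ Fintype.card I * Real.exp (l ^ 2 / 2) + 2 ^ Fintype.card I * Real.exp (l ^ 2 / 2))) := by
        gcongr
    _ = 2 ^ Fintype.card I * ((6 + l ^ 2) * Real.exp (-l ^ 2 / 2)) := by
        have : Real.exp (-l ^ 2 / 2) = Real.exp (-l ^ 2) * Real.exp (l ^ 2 / 2) := by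
          rw [← Real.exp_add]; congr 1; ring
        rw [this]; ring
    _ ≤ _ := by
        apply mul_le_mul_of_nonneg_left _ (by positivity)
        have : Real.exp (-l ^ 2 / 4) = Real.exp (-l ^ 2 / 2) * Real.exp (l ^ 2 / 4) := by
          rw [← Real.exp_add]; congr 1; ring
        rw [this]
        have h3 := Real.add_one_le_exp (l ^ 2 / 4)
        nlinarith [Real.exp_pos (-l ^ 2 / 2), mul_le_mul_of_nonneg_left h3 (Real.exp_pos (-l ^ 2 / 2)).le, sq_nonneg l, mul_nonneg (Real.exp_pos (-l ^ 2 / 2)).le (sq_nonneg l)]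

lemma hamming_ball {I : Type*} [Fintype I] [DecidableEq I] (e0 : I → Bool) (S : Finset (I → Bool))
    (hS : ∀ e ∈ S, 10 * (Finset.univ.filter (fun i => e i ≠ e0 i)).card < Fintype.card I) :
    (S.card : ℝ) ≤ Real.exp (0.34 * Fintype.card I) := by
  set m := Fintype.card I
  have h1 : ∀ e : I → Bool, Real.exp (-2 * ((Finset.univ.filter (fun i => e i ≠ e0 i)).card : ℝ))
      = ∏ i, (if e i ≠ e0 i then Real.exp (-2) else 1) := by
    intro e
    rw [Finset.prod_ite]
    simp only [Finset.prod_const, one_pow, mul_one]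
    rw [mul_comm, Real.exp_nat_mul]
  have h2 := Finset.prod_univ_sum (fun _ : I => (Finset.univ : Finset Bool))
    (fun i b => if b ≠ e0 i then Real.exp (-2) else 1)
  rw [Fintype.piFinset_univ] at h2
  have h3 : ∀ i, ∑ b : Bool, (if b ≠ e0 i then Real.exp (-2) else 1) = 1 + Real.exp (-2) := by
    intro i
    cases h : e0 i <;> simp [add_comm]
  have h4 : ∑ e : I → Bool, Real.exp (-2 * ((Finset.univ.filter (fun i => e i ≠ e0 i)).card : ℝ))
      = (1 + Real.exp (-2)) ^ m := by
    simp_rw [h1]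
    rw [← h2]
    simp_rw [h3]
    simp [m]
  have h5 : Real.exp (-2) ≤ 0.14 := by
    have : Real.exp 2 = Real.exp 1 ^ 2 := by rw [← Real.exp_nat_mul]; norm_num
    rw [Real.exp_neg, this]
    have h := Real.exp_one_gt_d9
    have : (7.3 : ℝ) ≤ Real.exp 1 ^ 2 := by nlinarith
    calc (Real.exp 1 ^ 2)⁻¹ ≤ (7.3 : ℝ)⁻¹ := inv_anti₀ (by norm_num) this
      _ ≤ 0.14 := by norm_num
  have h6 : (1 + Real.exp (-2)) ^ m ≤ Real.exp (0.14 * m) := by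
    rw [mul_comm, Real.exp_nat_mul]
    apply pow_le_pow_left₀ (by positivity)
    have := Real.add_one_le_exp (0.14 : ℝ)
    linarith
  have h7 : (S.card : ℝ) * Real.exp (-0.2 * m) ≤ Real.exp (0.14 * m) := by
    rw [← nsmul_eq_mul, ← Finset.sum_const]
    calc _ ≤ ∑ e ∈ S, Real.exp (-2 * ((Finset.univ.filter (fun i => e i ≠ e0 i)).card : ℝ)) := by
          apply Finset.sum_le_sum
          intro e he
          apply Real.exp_le_exp.mpr
          have : (10 : ℝ) * ((Finset.univ.filter (fun i => e i ≠ e0 i)).card : ℝ) < m := by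
            exact_mod_cast hS e he
          linarith
      _ ≤ ∑ e : I → Bool, Real.exp (-2 * ((Finset.univ.filter (fun i => e i ≠ e0 i)).card : ℝ)) :=
          Finset.sum_le_sum_of_subset_of_nonneg (Finset.subset_univ _) (fun _ _ _ => (Real.exp_pos _).le)
      _ ≤ _ := h4.trans_le h6
  have : Real.exp (0.34 * m) = Real.exp (0.14 * m) / Real.exp (-0.2 * m) := by
    rw [← Real.exp_sub]; congr 1; ring
  rw [this, le_div_iff₀ (Real.exp_pos _)]
  exact h7

lemma partial_coloring {I J : Type*} [Fintype I] [DecidableEq I] [Fintype J]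
    (a : J → I → ℝ) (s l : J → ℝ) (hs : ∀ j, 0 < s j) (hl : ∀ j, 2 ≤ l j)
    (hvar : ∀ j, ∑ i, a j i ^ 2 ≤ s j ^ 2)
    (hcost : ∑ j, 6 * Real.exp (-(l j) ^ 2 / 4) ≤ (Fintype.card I : ℝ) / 20)
    (hI : 4 ≤ Fintype.card I) :
    ∃ χ : I → ℝ, (∀ i, χ i = 0 ∨ χ i = 1 ∨ χ i = -1) ∧
      Fintype.card I ≤ 10 * (Finset.univ.filter (fun i => χ i ≠ 0)).card ∧
      ∀ j, |∑ i, a j i * χ i| ≤ l j * s j := by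
  classical
  set m := Fintype.card I with hm
  have hm4 : (4 : ℝ) ≤ m := by exact_mod_cast hI
  let L : (I → Bool) → J → ℝ := fun ε j => ∑ i, a j i * sgnB (ε i)
  let b : (I → Bool) → J → ℤ := fun ε j => round (L ε j / (2 * (l j * s j)))
  let T : ℝ := m / 10
  let S : Finset (I → Bool) := Finset.univ.filter (fun ε => ∑ j, codeCost (l j) (b ε j) ≤ T)
  have hT : 0 < T := by simp only [T]; positivity
  -- Markov
  have hmean : ∑ ε : I → Bool, ∑ j, codeCost (l j) (b ε j) ≤ 2 ^ m * (T / 2) := by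
    rw [Finset.sum_comm]
    calc _ ≤ ∑ j, 2 ^ m * (6 * Real.exp (-(l j) ^ 2 / 4)) :=
          Finset.sum_le_sum (fun j _ => cost_mean (a j) (l j) (s j) (hl j) (hs j) (hvar j))
      _ = 2 ^ m * ∑ j, (6 * Real.exp (-(l j) ^ 2 / 4)) := by rw [Finset.mul_sum]
      _ ≤ _ := by
          apply mul_le_mul_of_nonneg_left _ (by positivity)
          simp only [T]; linarith
  have hScard : (2 : ℝ) ^ m / 2 ≤ S.card := by
    have h1 : ((Finset.univ.filter (fun ε => ¬ (∑ j, codeCost (l j) (b ε j) ≤ T))).card : ℝ) * T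
        ≤ 2 ^ m * (T / 2) := by
      rw [← nsmul_eq_mul, ← Finset.sum_const]
      refine le_trans ?_ hmean
      calc _ ≤ ∑ ε ∈ (Finset.univ.filter (fun ε => ¬ (∑ j, codeCost (l j) (b ε j) ≤ T))), ∑ j, codeCost (l j) (b ε j) := by
            apply Finset.sum_le_sum
            intro ε hε
            rw [Finset.mem_filter] at hε
            exact (not_le.mp hε.2).le
        _ ≤ _ := Finset.sum_le_sum_of_subset_of_nonneg (Finset.subset_univ _)
            (fun _ _ _ => Finset.sum_nonneg (fun j _ => codeCost_nonneg _ _))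
    have h2 : (S.card : ℝ) + ((Finset.univ.filter (fun ε => ¬ (∑ j, codeCost (l j) (b ε j) ≤ T))).card : ℝ) = 2 ^ m := by
      have := Finset.card_filter_add_card_filter_not (s := (Finset.univ : Finset (I → Bool))) (fun ε => ∑ j, codeCost (l j) (b ε j) ≤ T)
      have h3 : (Finset.univ : Finset (I → Bool)).card = 2 ^ m := by simp [hm]
      rw [h3] at this
      exact_mod_cast this
    have h4 : ((Finset.univ.filter (fun ε => ¬ (∑ j, codeCost (l j) (b ε j) ≤ T))).card : ℝ) ≤ 2 ^ m / 2 := by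
      have : 2 ^ m * (T / 2) = (2 ^ m / 2) * T := by ring
      rw [this] at h1
      exact le_of_mul_le_mul_right h1 hT
    linarith
  -- number of classes
  have himg : ((S.image b).card : ℝ) ≤ Real.exp T := by
    have h1 : ∑ β ∈ S.image b, ∏ j, Real.exp (-codeCost (l j) (β j)) ≤ 1 := by
      calc _ ≤ ∑ β ∈ Fintype.piFinset (fun j => (S.image b).image (fun β => β j)),
            ∏ j, Real.exp (-codeCost (l j) (β j)) := by
            apply Finset.sum_le_sum_of_subset_of_nonneg
            · intro β hβ
              rw [Fintype.mem_piFinset]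
              intro j
              exact Finset.mem_image_of_mem _ hβ
            · intro _ _ _
              exact Finset.prod_nonneg (fun _ _ => (Real.exp_pos _).le)
        _ = ∏ j, ∑ k ∈ (S.image b).image (fun β => β j), Real.exp (-codeCost (l j) k) := by
            rw [Finset.prod_univ_sum]
        _ ≤ ∏ j : J, (1 : ℝ) := Finset.prod_le_prod
            (fun j _ => Finset.sum_nonneg (fun _ _ => (Real.exp_pos _).le))
            (fun j _ => kraft (l j) (hl j) _)
        _ = 1 := by simp
    have h2 : ((S.image b).card : ℝ) * Real.exp (-T) ≤ 1 := by
      rw [← nsmul_eq_mul, ← Finset.sum_const]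
      refine le_trans (Finset.sum_le_sum ?_) h1
      intro β hβ
      rw [Finset.mem_image] at hβ
      obtain ⟨ε, hε, rfl⟩ := hβ
      rw [← Real.exp_sum, Finset.sum_neg_distrib]
      apply Real.exp_le_exp.mpr
      have := (Finset.mem_filter.mp hε).2
      linarith
    rw [Real.exp_neg, ← div_eq_mul_inv, div_le_iff₀ (Real.exp_pos _), one_mul] at h2
    exact h2
  -- two far-apart colourings in one class
  obtain ⟨e, e', hb, hd⟩ : ∃ e e' : I → Bool, b e = b e' ∧
      m ≤ 10 * (Finset.univ.filter (fun i => e i ≠ e' i)).card := by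
    by_contra hcon
    push Not at hcon
    have hfib : ∀ β ∈ S.image b, ((S.filter (fun e => b e = β)).card : ℝ) ≤ Real.exp (0.34 * m) := by
      intro β hβ
      obtain ⟨e0, he0, rfl⟩ := Finset.mem_image.mp hβ
      apply hamming_ball e0
      intro e he
      exact hcon e e0 (Finset.mem_filter.mp he).2
    have h1 : (S.card : ℝ) ≤ Real.exp T * Real.exp (0.34 * m) := by
      rw [Finset.card_eq_sum_card_image b S]
      push_cast
      calc _ ≤ ∑ β ∈ S.image b, Real.exp (0.34 * m) := Finset.sum_le_sum hfib
        _ = ((S.image b).card : ℝ) * Real.exp (0.34 * m) := by rw [Finset.sum_const, nsmul_eq_mul]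
        _ ≤ _ := by gcongr
    have h2 : (2 : ℝ) ^ m / 2 = Real.exp (Real.log 2 * (m - 1)) := by
      rw [mul_sub, mul_one, Real.exp_sub, Real.exp_log (by norm_num), mul_comm, Real.exp_nat_mul,
        Real.exp_log (by norm_num)]
    rw [← Real.exp_add] at h1
    have h3 := hScard.trans h1
    rw [h2, Real.exp_le_exp] at h3
    have h4 := Real.log_two_gt_d9
    simp only [T] at h3
    nlinarith
  refine ⟨fun i => (sgnB (e i) - sgnB (e' i)) / 2, ?_, ?_, ?_⟩
  · intro i
    rcases h1 : e i with _ | _ <;> rcases h2 : e' i with _ | _ <;>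
      simp only [sgnB, h1, h2] <;> norm_num
  · refine hd.trans (Nat.mul_le_mul_left _ (Finset.card_le_card ?_))
    intro i hi
    rw [Finset.mem_filter] at hi ⊢
    refine ⟨Finset.mem_univ _, ?_⟩
    have h0 := hi.2
    rcases h1 : e i with _ | _ <;> rcases h2 : e' i with _ | _ <;>
      simp [sgnB, h1, h2] at h0 ⊢ <;> try norm_num
  · intro j
    have h1 : ∑ i, a j i * ((sgnB (e i) - sgnB (e' i)) / 2) = (L e j - L e' j) / 2 := by
      simp only [L]
      rw [← Finset.sum_sub_distrib, Finset.sum_div]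
      apply Finset.sum_congr rfl
      intro i _
      ring
    rw [h1]
    have hp : 0 < l j * s j := mul_pos (by linarith [hl j]) (hs j)
    have hbj : round (L e j / (2 * (l j * s j))) = round (L e' j / (2 * (l j * s j))) := congrFun hb j
    have r1 := abs_sub_round (L e j / (2 * (l j * s j)))
    have r2 := abs_sub_round (L e' j / (2 * (l j * s j)))
    rw [hbj] at r1
    have h2 : |L e j / (2 * (l j * s j)) - L e' j / (2 * (l j * s j))| ≤ 1 := by
      rw [abs_le] at r1 r2 ⊢
      constructor <;> linarith
    rw [← sub_div, abs_div, abs_of_pos (by positivity : 0 < 2 * (l j * s j)), div_le_iff₀ (by positivity)] at h2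
    rw [abs_div, abs_of_pos (by norm_num : (0 : ℝ) < 2)]
    linarith


lemma grouping {ι κ : Type*} [DecidableEq ι] [DecidableEq κ] (f : ι → κ) (K : Finset κ) :
    ∀ (n : ℕ) (S : Finset ι), S.card = n → (∀ i ∈ S, f i ∈ K) →
    ∃ G : Finset (Finset ι), (∀ g ∈ G, g ⊆ S ∧ g.card = 5 ∧ ∀ i ∈ g, ∀ j ∈ g, f i = f j) ∧
      (∀ g ∈ G, ∀ g' ∈ G, g ≠ g' → Disjoint g g') ∧ S.card ≤ 5 * G.card + 4 * K.card := by
  intro n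
  induction n using Nat.strong_induction_on with
  | _ n ih =>
    intro S hn hS
    by_cases h : S.card ≤ 4 * K.card
    · exact ⟨∅, by simp, by simp, by simpa using h⟩
    · push Not at h
      obtain ⟨k, hk, hk2⟩ := Finset.exists_lt_card_fiber_of_mul_lt_card_of_maps_to hS
        (by rw [mul_comm]; exact h)
      obtain ⟨g, hg, hg5⟩ := Finset.exists_subset_card_eq (show 5 ≤ _ from hk2)
      have hgS : g ⊆ S := hg.trans (Finset.filter_subset _ _)
      have hc : (S \ g).card = n - 5 := by rw [Finset.card_sdiff_of_subset hgS, hn, hg5]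
      have hn5 : 5 ≤ n := by rw [← hn, ← hg5]; exact Finset.card_le_card hgS
      obtain ⟨G, h1, h2, h3⟩ := ih (n - 5) (by omega) (S \ g) hc
        (fun i hi => hS i (Finset.mem_sdiff.mp hi).1)
      have hd : ∀ g' ∈ G, Disjoint g g' := fun g' hg' =>
        (Finset.disjoint_sdiff).mono_right (h1 g' hg').1
      have hgG : g ∉ G := by
        intro hgG
        have := hd g hgG
        rw [disjoint_self] at this
        rw [this] at hg5
        simp at hg5
      refine ⟨insert g G, ?_, ?_, ?_⟩
      · intro g' hg'
        rcases Finset.mem_insert.mp hg' with rfl | hg'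
        · refine ⟨hgS, hg5, fun i hi j hj => ?_⟩
          rw [(Finset.mem_filter.mp (hg hi)).2, (Finset.mem_filter.mp (hg hj)).2]
        · obtain ⟨a, b, c⟩ := h1 g' hg'
          exact ⟨a.trans Finset.sdiff_subset, b, c⟩
      · intro a ha b hb hab
        rcases Finset.mem_insert.mp ha with e1 | ha1 <;> rcases Finset.mem_insert.mp hb with e2 | hb1
        · exact absurd (e1.trans e2.symm) hab
        · rw [e1]; exact hd b hb1
        · rw [e2]; exact (hd a ha1).symm
        · exact h2 a ha1 b hb1 hab
      · rw [Finset.card_insert_of_notMem hgG]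
        omega

lemma kernel_vec {ι : Type*} [DecidableEq ι] (q : ι → Fin 4 → ℝ) (w : ι → ℝ) (g : Finset ι)
    (hg : g.card = 5) (hw : ∀ i ∈ g, 0 < w i) :
    ∃ v : ι → ℝ, (∀ i, i ∉ g → v i = 0) ∧ (∀ i ∈ g, |v i| ≤ w i) ∧ (∃ i ∈ g, v i = - w i) ∧
      ∀ k, ∑ i ∈ g, v i * q i k = 0 := by
  let A : (g → ℝ) →ₗ[ℝ] (Fin 4 → ℝ) := 
    { toFun := fun x k => ∑ i : g, x i * q i k
      map_add' := by intro x y; ext k; simp [add_mul, Finset.sum_add_distrib]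
      map_smul' := by intro c x; ext k; simp [Finset.mul_sum, mul_assoc] }
  have hk : LinearMap.ker A ≠ ⊥ := by
    apply LinearMap.ker_ne_bot_of_finrank_lt
    simp [hg]
  obtain ⟨x, hx, hx0⟩ := (Submodule.ne_bot_iff _).mp hk
  have hne : (Finset.univ : Finset g).Nonempty := by
    rw [Finset.univ_nonempty_iff]
    have : g.Nonempty := Finset.card_pos.mp (by omega)
    exact this.to_subtype
  obtain ⟨i0, -, hmax⟩ := Finset.exists_max_image Finset.univ (fun i : g => |x i| / w i) hne
  have hxi0 : x i0 ≠ 0 := by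
    intro h0
    apply hx0
    ext i
    have h1 := hmax i (Finset.mem_univ _)
    simp only [h0, abs_zero, zero_div] at h1
    have h2 := hw i i.2
    rw [div_le_iff₀ h2, zero_mul] at h1
    exact abs_eq_zero.mp (le_antisymm h1 (abs_nonneg _))
  have hw0 := hw i0 i0.2
  refine ⟨fun i => if h : i ∈ g then - (w i0 / x i0) * x ⟨i, h⟩ else 0, ?_, ?_, ?_, ?_⟩
  · intro i hi; simp [hi]
  · intro i hi
    simp only [hi, dite_true]
    have h1 := hmax ⟨i, hi⟩ (Finset.mem_univ _)
    have h2 := hw i hi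
    have h3 : 0 < |x i0| := abs_pos.mpr hxi0
    simp only at h1
    rw [div_le_div_iff₀ h2 hw0] at h1
    rw [abs_mul, abs_neg, abs_div, abs_of_pos hw0, div_mul_eq_mul_div, div_le_iff₀ h3]
    linarith
  · refine ⟨i0, i0.2, ?_⟩
    simp only [i0.2, dite_true]
    field_simp
  · intro k
    have h1 : ∑ i : g, x i * q i k = 0 := congrFun (LinearMap.mem_ker.mp hx) k
    rw [← Finset.sum_coe_sort g]
    have h2 : ∀ i : g, (if h : (i:ι) ∈ g then - (w i0 / x i0) * x ⟨i, h⟩ else 0) * q i k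
        = - (w i0 / x i0) * (x i * q i k) := by
      intro i
      simp only [i.2, dite_true]
      ring
    rw [Finset.sum_congr rfl (fun i _ => h2 i), ← Finset.mul_sum, h1, mul_zero]


/-- choose the majority sign -/
lemma coloring_majority {I J : Type*} [Fintype I] [DecidableEq I] [Fintype J]
    (a : J → I → ℝ) (s l : J → ℝ) (hs : ∀ j, 0 < s j) (hl : ∀ j, 2 ≤ l j)
    (hvar : ∀ j, ∑ i, a j i ^ 2 ≤ s j ^ 2)
    (hcost : ∑ j, 6 * Real.exp (-(l j) ^ 2 / 4) ≤ (Fintype.card I : ℝ) / 20)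
    (hI : 4 ≤ Fintype.card I) :
    ∃ χ : I → ℝ, (∀ i, |χ i| ≤ 1) ∧
      Fintype.card I ≤ 20 * (Finset.univ.filter (fun i => χ i = 1)).card ∧
      ∀ j, |∑ i, a j i * χ i| ≤ l j * s j := by
  obtain ⟨χ, h1, h2, h3⟩ := partial_coloring a s l hs hl hvar hcost hI
  have hsplit : (Finset.univ.filter (fun i => χ i ≠ 0)).card ≤
      (Finset.univ.filter (fun i => χ i = 1)).card + (Finset.univ.filter (fun i => χ i = -1)).card := by
    rw [← Finset.card_union_of_disjoint]
    · apply Finset.card_le_card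
      intro i hi
      simp only [Finset.mem_filter, Finset.mem_univ, true_and, Finset.mem_union] at hi ⊢
      rcases h1 i with h | h | h
      · exact absurd h hi
      · exact Or.inl h
      · exact Or.inr h
    · rw [Finset.disjoint_filter]
      intro i _ h h'
      rw [h] at h'; norm_num at h'
  have habs : ∀ i, |χ i| ≤ 1 := by
    intro i
    rcases h1 i with h | h | h <;> rw [h] <;> norm_num
  by_cases hc : (Finset.univ.filter (fun i => χ i = -1)).card ≤ (Finset.univ.filter (fun i => χ i = 1)).card
  · exact ⟨χ, habs, by omega, h3⟩
  · refine ⟨fun i => - χ i, fun i => by rw [abs_neg]; exact habs i, ?_, ?_⟩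
    · have : (Finset.univ.filter (fun i => - χ i = 1)) = (Finset.univ.filter (fun i => χ i = -1)) := by
        ext i
        simp only [Finset.mem_filter, Finset.mem_univ, true_and]
        constructor <;> intro h <;> linarith
      rw [this]; omega
    · intro j
      have : ∑ i, a j i * - χ i = - ∑ i, a j i * χ i := by
        rw [← Finset.sum_neg_distrib]; apply Finset.sum_congr rfl; intros; ring
      rw [this, abs_neg]; exact h3 j

lemma abstract_step {ι κ J : Type*} [Fintype ι] [DecidableEq ι] [DecidableEq κ] [Fintype J]
    (f : ι → κ) (K : Finset κ) (hK : K.Nonempty) (hf : ∀ i, f i ∈ K) (q : ι → Fin 4 → ℝ)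
    (w : ι → ℝ) (hw : ∀ i, 0 ≤ w i) (μ : ℝ)
    (hμ : ∀ k, ∑ i with f i = k, w i ≤ μ)
    (F : J → ι → ℝ) (Bad : J → Finset κ) (δ s l : J → ℝ)
    (hgood : ∀ j k, k ∉ Bad j → ∃ t : Fin 4 → ℝ, ∀ i, f i = k → F j i = ∑ x, t x * q i x)
    (hbad : ∀ j i, f i ∈ Bad j → |F j i| ≤ δ j)
    (hδ : ∀ j, 0 ≤ δ j)
    (hs : ∀ j, 0 < s j) (hl : ∀ j, 2 ≤ l j)
    (hvar : ∀ j, δ j ^ 2 * ((Bad j).card * μ ^ 2) ≤ s j ^ 2)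
    (hcost : ∑ j, 6 * Real.exp (-(l j) ^ 2 / 4) ≤ (K.card : ℝ))
    (hN : 104 * K.card < (Finset.univ.filter (fun i => w i ≠ 0)).card) :
    ∃ w' : ι → ℝ, (∀ i, 0 ≤ w' i) ∧ (∀ i, |w' i - w i| ≤ w i) ∧
      (Finset.univ.filter (fun i => w' i ≠ 0)).card + K.card
        ≤ (Finset.univ.filter (fun i => w i ≠ 0)).card ∧
      (∀ k x, ∑ i with f i = k, w' i * q i x = ∑ i with f i = k, w i * q i x) ∧
      ∀ j, |∑ i, (w' i - w i) * F j i| ≤ l j * s j := by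
  set S := Finset.univ.filter (fun i => w i ≠ 0) with hSdef
  obtain ⟨G, hG1, hG2, hG3⟩ := grouping f K _ S rfl (fun i _ => hf i)
  have hKpos := hK.card_pos
  have hwpos : ∀ g ∈ G, ∀ i ∈ g, 0 < w i := by
    intro g hg i hi
    have := (Finset.mem_filter.mp ((hG1 g hg).1 hi)).2
    exact lt_of_le_of_ne (hw i) (Ne.symm this)
  have hex : ∀ g : G, ∃ v : ι → ℝ, (∀ i, i ∉ g.1 → v i = 0) ∧ (∀ i ∈ g.1, |v i| ≤ w i) ∧
      (∃ i ∈ g.1, v i = - w i) ∧ ∀ k, ∑ i ∈ g.1, v i * q i k = 0 := fun g =>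
    kernel_vec q w g.1 (hG1 g.1 g.2).2.1 (hwpos g.1 g.2)
  choose v hv0 hvw hvm hvq using hex
  choose p hp hpm using hvm
  have hcardG : Fintype.card G = G.card := Fintype.card_coe G
  let a : J → G → ℝ := fun j g => ∑ i ∈ g.1, v g i * F j i
  -- bounds on a
  have hW : ∀ g : G, ∑ i ∈ g.1, w i ≤ μ := by
    intro g
    obtain ⟨i0, hi0⟩ : g.1.Nonempty := Finset.card_pos.mp (by rw [(hG1 g.1 g.2).2.1]; norm_num)
    refine le_trans ?_ (hμ (f i0))
    apply Finset.sum_le_sum_of_subset_of_nonneg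
    · intro i hi
      simp only [Finset.mem_filter, Finset.mem_univ, true_and]
      exact (hG1 g.1 g.2).2.2 i hi i0 hi0
    · intro i _ _; exact hw i
  have hW0 : ∀ g : G, 0 ≤ ∑ i ∈ g.1, w i := fun g => Finset.sum_nonneg (fun i _ => hw i)
  have ha0 : ∀ j (g : G), (¬ ∃ i ∈ g.1, f i ∈ Bad j) → a j g = 0 := by
    intro j g h
    push Not at h
    obtain ⟨i0, hi0⟩ : g.1.Nonempty := Finset.card_pos.mp (by rw [(hG1 g.1 g.2).2.1]; norm_num)
    obtain ⟨t, ht⟩ := hgood j (f i0) (h i0 hi0)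
    have : a j g = ∑ i ∈ g.1, ∑ x, t x * (v g i * q i x) := by
      apply Finset.sum_congr rfl
      intro i hi
      rw [ht i ((hG1 g.1 g.2).2.2 i hi i0 hi0), Finset.mul_sum]
      apply Finset.sum_congr rfl; intros; ring
    rw [this, Finset.sum_comm]
    apply Finset.sum_eq_zero
    intro x _
    rw [← Finset.mul_sum, hvq, mul_zero]
  have ha1 : ∀ j (g : G), (∃ i ∈ g.1, f i ∈ Bad j) → |a j g| ≤ δ j * ∑ i ∈ g.1, w i := by
    rintro j g ⟨i0, hi0, hb⟩
    rw [Finset.mul_sum]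
    refine (Finset.abs_sum_le_sum_abs _ _).trans (Finset.sum_le_sum fun i hi => ?_)
    rw [abs_mul, mul_comm]
    have h1 : f i ∈ Bad j := by rw [(hG1 g.1 g.2).2.2 i hi i0 hi0]; exact hb
    exact mul_le_mul (hbad j i h1) (hvw g i hi) (abs_nonneg _) (hδ j)
  have hvar' : ∀ j, ∑ g, a j g ^ 2 ≤ s j ^ 2 := by
    intro j
    refine le_trans ?_ (hvar j)
    classical
    have h1 : ∀ g : G, a j g ^ 2 ≤ δ j ^ 2 * μ * (if ∃ i ∈ g.1, f i ∈ Bad j then ∑ i ∈ g.1, w i else 0) := by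
      intro g
      split_ifs with h
      · have e1 := ha1 j g h
        have e2 := hW g
        have e3 := hW0 g
        calc a j g ^ 2 = |a j g| ^ 2 := (sq_abs _).symm
          _ ≤ (δ j * ∑ i ∈ g.1, w i) ^ 2 := pow_le_pow_left₀ (abs_nonneg _) e1 2
          _ = δ j ^ 2 * ((∑ i ∈ g.1, w i) * (∑ i ∈ g.1, w i)) := by ring
          _ ≤ δ j ^ 2 * (μ * (∑ i ∈ g.1, w i)) := by gcongr
          _ = _ := by ring
      · rw [ha0 j g h]; simp
    obtain ⟨k0, hk0⟩ := hK
    have hμ0 : 0 ≤ μ := le_trans (Finset.sum_nonneg fun i _ => hw i) (hμ k0)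
    have h2 : ∑ g : G, (if ∃ i ∈ g.1, f i ∈ Bad j then ∑ i ∈ g.1, w i else 0) ≤ (Bad j).card * μ := by
      rw [Finset.sum_coe_sort G (fun g => if ∃ i ∈ g, f i ∈ Bad j then ∑ i ∈ g, w i else 0),
        ← Finset.sum_filter, ← Finset.sum_biUnion]
      · calc _ ≤ ∑ i with f i ∈ Bad j, w i := by
              apply Finset.sum_le_sum_of_subset_of_nonneg
              · intro i hi
                simp only [Finset.mem_biUnion, Finset.mem_filter, Finset.mem_univ, true_and] at hi ⊢
                obtain ⟨g, ⟨hg, i0, hi0, hb⟩, hig⟩ := hi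
                rw [(hG1 g hg).2.2 i hig i0 hi0]; exact hb
              · intro i _ _; exact hw i
          _ = ∑ k ∈ Bad j, ∑ i with f i = k, w i := by
              rw [← Finset.sum_fiberwise_of_maps_to (g := f) (t := Bad j)]
              · apply Finset.sum_congr rfl
                intro k hk
                apply Finset.sum_congr _ (fun _ _ => rfl)
                ext i
                simp only [Finset.mem_filter, Finset.mem_univ, true_and]
                constructor
                · exact fun h => h.2
                · intro h; exact ⟨h ▸ hk, h⟩
              · intro i hi; exact (Finset.mem_filter.mp hi).2
          _ ≤ ∑ k ∈ Bad j, μ := Finset.sum_le_sum fun k _ => hμ k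
          _ = _ := by rw [Finset.sum_const, nsmul_eq_mul]
      · intro g hg g' hg' hne
        exact hG2 g (Finset.mem_filter.mp hg).1 g' (Finset.mem_filter.mp hg').1 hne
    calc _ ≤ ∑ g : G, δ j ^ 2 * μ * (if ∃ i ∈ g.1, f i ∈ Bad j then ∑ i ∈ g.1, w i else 0) :=
          Finset.sum_le_sum fun g _ => h1 g
      _ = δ j ^ 2 * μ * ∑ g : G, (if ∃ i ∈ g.1, f i ∈ Bad j then ∑ i ∈ g.1, w i else 0) := by
          rw [Finset.mul_sum]
      _ ≤ δ j ^ 2 * μ * ((Bad j).card * μ) := by gcongr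
      _ = _ := by ring
  have hcost' : ∑ j, 6 * Real.exp (-(l j) ^ 2 / 4) ≤ (Fintype.card G : ℝ) / 20 := by
    refine hcost.trans ?_
    rw [hcardG, le_div_iff₀ (by norm_num)]
    have : K.card * 20 ≤ G.card := by omega
    exact_mod_cast this
  obtain ⟨χ, hχ1, hχ2, hχ3⟩ := coloring_majority a s l hs hl hvar' hcost' (by rw [hcardG]; omega)
  rw [hcardG] at hχ2
  let Δ : ι → ℝ := fun i => ∑ g : G, χ g * v g i
  have hΔ0 : ∀ i, (∀ g : G, i ∉ g.1) → Δ i = 0 := by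
    intro i h
    apply Finset.sum_eq_zero
    intro g _
    rw [hv0 g i (h g), mul_zero]
  have hΔ1 : ∀ i (g : G), i ∈ g.1 → Δ i = χ g * v g i := by
    intro i g hi
    apply Finset.sum_eq_single_of_mem g (Finset.mem_univ _)
    intro g' _ hne
    have hd := hG2 g'.1 g'.2 g.1 g.2 (fun h => hne (Subtype.ext h))
    rw [hv0 g' i (fun h => (Finset.disjoint_left.mp hd h) hi), mul_zero]
  have hΔ : ∀ i, |Δ i| ≤ w i := by
    intro i
    by_cases h : ∃ g : G, i ∈ g.1
    · obtain ⟨g, hg⟩ := h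
      rw [hΔ1 i g hg, abs_mul]
      calc |χ g| * |v g i| ≤ 1 * w i :=
            mul_le_mul (hχ1 g) (hvw g i hg) (abs_nonneg _) zero_le_one
        _ = w i := one_mul _
    · push Not at h
      rw [hΔ0 i h, abs_zero]; exact hw i
  have hsumΔ : ∀ (H : ι → ℝ), ∑ i, Δ i * H i = ∑ g : G, χ g * ∑ i ∈ g.1, v g i * H i := by
    intro H
    simp only [Δ, Finset.sum_mul]
    rw [Finset.sum_comm]
    apply Finset.sum_congr rfl
    intro g _
    rw [Finset.mul_sum]
    rw [← Finset.sum_subset (Finset.subset_univ g.1)]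
    · apply Finset.sum_congr rfl; intros; ring
    · intro i _ hi; rw [hv0 g i hi]; ring
  refine ⟨fun i => w i + Δ i, ?_, ?_, ?_, ?_, ?_⟩
  · intro i
    have := (abs_le.mp (hΔ i)).1
    linarith
  · intro i
    have : w i + Δ i - w i = Δ i := by ring
    rw [this]; exact hΔ i
  · -- support
    set P := Finset.univ.filter (fun g : G => χ g = 1) with hP
    have hinj : Set.InjOn p P := by
      intro g hg g' hg' he
      by_contra hne
      have hd := hG2 g.1 g.2 g'.1 g'.2 (fun h => hne (Subtype.ext h))
      exact Finset.disjoint_left.mp hd (hp g) (he ▸ hp g')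
    have hPc : (P.image p).card = P.card := Finset.card_image_of_injOn hinj
    have hPS : P.image p ⊆ S := by
      intro i hi
      obtain ⟨g, hg, rfl⟩ := Finset.mem_image.mp hi
      exact (hG1 g.1 g.2).1 (hp g)
    have hsub : (Finset.univ.filter (fun i => w i + Δ i ≠ 0)) ⊆ S \ P.image p := by
      intro i hi
      have hi' := (Finset.mem_filter.mp hi).2
      rw [Finset.mem_sdiff]
      constructor
      · rw [hSdef, Finset.mem_filter]
        refine ⟨Finset.mem_univ _, fun h0 => hi' ?_⟩
        have := hΔ i
        rw [h0] at this
        rw [h0, abs_eq_zero.mp (le_antisymm this (abs_nonneg _)), add_zero]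
      · intro h
        obtain ⟨g, hg, rfl⟩ := Finset.mem_image.mp h
        apply hi'
        rw [hΔ1 _ g (hp g), hpm, (Finset.mem_filter.mp hg).2]
        ring
    have h1 := Finset.card_le_card hsub
    rw [Finset.card_sdiff_of_subset hPS, hPc] at h1
    have h2 : P.card ≤ S.card := by rw [← hPc]; exact Finset.card_le_card hPS
    change (Finset.univ.filter (fun i => w i + Δ i ≠ 0)).card + K.card ≤ S.card
    omega
  · intro k x
    have h1 : ∑ i with f i = k, Δ i * q i x = 0 := by
      have e1 : ∑ i with f i = k, Δ i * q i x = ∑ i, Δ i * (if f i = k then q i x else 0) := by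
        rw [Finset.sum_filter]
        apply Finset.sum_congr rfl
        intro i _
        split_ifs <;> simp
      rw [e1, hsumΔ]
      apply Finset.sum_eq_zero
      intro g _
      obtain ⟨i0, hi0⟩ : g.1.Nonempty := Finset.card_pos.mp (by rw [(hG1 g.1 g.2).2.1]; norm_num)
      have e2 : ∑ i ∈ g.1, v g i * (if f i = k then q i x else 0)
          = ∑ i ∈ g.1, v g i * (if f i0 = k then q i x else 0) := by
        apply Finset.sum_congr rfl
        intro i hi
        rw [(hG1 g.1 g.2).2.2 i hi i0 hi0]
      rw [e2]
      split_ifs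
      · rw [hvq, mul_zero]
      · simp
    simp only [add_mul, Finset.sum_add_distrib]
    rw [h1, add_zero]
  · intro j
    have h1 : ∑ i, (w i + Δ i - w i) * F j i = ∑ g : G, a j g * χ g := by
      have : ∀ i, (w i + Δ i - w i) * F j i = Δ i * F j i := by intro i; ring
      simp only [this]
      rw [hsumΔ]
      apply Finset.sum_congr rfl
      intro g _
      exact mul_comm _ _
    rw [h1]
    exact hχ3 j


/-- affine function with coefficient vector `c` -/
def linF (c : Fin 3 → ℝ) (u v : ℝ) : ℝ := c 0 * u + c 1 * v + c 2

/-- dyadic cell of level `l` -/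
noncomputable def cellL (l : ℕ) (u v : ℝ) : ℕ × ℕ := (⌊2 ^ l * u⌋₊, ⌊2 ^ l * v⌋₊)

/-- decay rate -/
noncomputable def etaC : ℝ := (Real.sqrt 32)⁻¹

lemma etaC_pos : 0 < etaC := by unfold etaC; positivity

lemma etaC_sq : etaC ^ 2 = 1 / 32 := by
  unfold etaC
  rw [inv_pow, Real.sq_sqrt (by norm_num)]; norm_num

lemma etaC_lt : etaC < 1 / 2 := by
  have := etaC_sq
  have := etaC_pos
  nlinarith

lemma etaC_ge : 1 / 8 ≤ etaC := by
  have := etaC_sq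
  have := etaC_pos
  nlinarith

/-- the affine function changes sign strictly in the (rescaled) unit cell -/
def crossing (l : ℕ) (c : Fin 3 → ℝ) (p : ℕ × ℕ) : Prop :=
  (∃ U V : ℝ, p.1 ≤ U ∧ U < p.1 + 1 ∧ p.2 ≤ V ∧ V < p.2 + 1 ∧ c 0 * U + c 1 * V + c 2 * 2 ^ l < 0) ∧
  (∃ U V : ℝ, p.1 ≤ U ∧ U < p.1 + 1 ∧ p.2 ≤ V ∧ V < p.2 + 1 ∧ 0 < c 0 * U + c 1 * V + c 2 * 2 ^ l)

lemma count_aux (n : ℕ) (s t : ℝ) (X : Finset (ℕ × ℕ))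
    (hX : ∀ p ∈ X, p.1 < n ∧ -2 < p.2 + s * p.1 + t ∧ p.2 + s * p.1 + t < 1) : X.card ≤ 3 * n := by
  have hsub : X ⊆ (Finset.range n ×ˢ Finset.range 3).image
      (fun a : ℕ × ℕ => (a.1, (⌊-(s * a.1 + t)⌋ - 1 + a.2).toNat)) := by
    rintro ⟨x, y⟩ hp
    obtain ⟨h1, h2, h3⟩ := hX _ hp
    simp only at h1 h2 h3
    set θ := -(s * x + t) with hθ
    have hf1 := Int.floor_le θ
    have hf2 := Int.lt_floor_add_one θ
    have e1 : (⌊θ⌋ : ℝ) - 2 < ((y : ℤ) : ℝ) := by push_cast; linarith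
    have e2 : ((y : ℤ) : ℝ) < (⌊θ⌋ : ℝ) + 2 := by push_cast; linarith
    have e1' : ⌊θ⌋ - 2 < (y : ℤ) := by exact_mod_cast e1
    have e2' : (y : ℤ) < ⌊θ⌋ + 2 := by exact_mod_cast e2
    rw [Finset.mem_image]
    refine ⟨(x, ((y : ℤ) - ⌊θ⌋ + 1).toNat), ?_, ?_⟩
    · rw [Finset.mem_product, Finset.mem_range, Finset.mem_range]
      exact ⟨h1, by dsimp only; omega⟩
    · refine Prod.ext rfl ?_
      change (⌊θ⌋ - 1 + ((((y : ℤ) - ⌊θ⌋ + 1).toNat : ℕ) : ℤ)).toNat = y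
      omega
  refine (Finset.card_le_card hsub).trans (Finset.card_image_le.trans ?_)
  rw [Finset.card_product, Finset.card_range, Finset.card_range, mul_comm]

lemma cross_aux (s t U V U' V' x y : ℝ) (hs : |s| ≤ 1) (h1 : x ≤ U) (h2 : U < x + 1) (h3 : y ≤ V)
    (h4 : V < y + 1) (h1' : x ≤ U') (h2' : U' < x + 1) (h3' : y ≤ V') (h4' : V' < y + 1)
    (hn : V + s * U + t < 0) (hp : 0 < V' + s * U' + t) :
    -2 < y + s * x + t ∧ y + s * x + t < 1 := by
  obtain ⟨a, b⟩ := abs_le.mp hs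
  constructor
  · nlinarith [mul_nonneg (sub_nonneg.mpr b) (sub_nonneg.mpr h1')]
  · nlinarith [mul_nonneg (by linarith : 0 ≤ s + 1) (sub_nonneg.mpr h1)]

lemma cross_aux2 (a b d : ℝ) (hab : |a| ≤ |b|) (hb : b ≠ 0) (U V U' V' x y : ℝ) 
    (h1 : x ≤ U) (h2 : U < x + 1) (h3 : y ≤ V)
    (h4 : V < y + 1) (h1' : x ≤ U') (h2' : U' < x + 1) (h3' : y ≤ V') (h4' : V' < y + 1)
    (hn : a * U + b * V + d < 0) (hp : 0 < a * U' + b * V' + d) :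
    -2 < y + a / b * x + d / b ∧ y + a / b * x + d / b < 1 := by
  have hs : |a / b| ≤ 1 := by
    rw [abs_div, div_le_one (abs_pos.mpr hb)]; exact hab
  have e : ∀ U V : ℝ, V + a / b * U + d / b = (a * U + b * V + d) / b := by
    intro U V; field_simp; ring
  rcases lt_or_gt_of_ne hb with h | h
  · apply cross_aux (a / b) (d / b) U' V' U V x y hs h1' h2' h3' h4' h1 h2 h3 h4
    · rw [e]; exact div_neg_of_pos_of_neg hp h
    · rw [e]; exact div_pos_of_neg_of_neg hn h
  · apply cross_aux (a / b) (d / b) U V U' V' x y hs h1 h2 h3 h4 h1' h2' h3' h4'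
    · rw [e]; exact div_neg_of_neg_of_pos hn h
    · rw [e]; exact div_pos hp h

open Classical in
lemma cross_count (l : ℕ) (c : Fin 3 → ℝ) :
    ((Finset.range (2 ^ l) ×ˢ Finset.range (2 ^ l)).filter (crossing l c)).card ≤ 3 * 2 ^ l := by
  by_cases h0 : c 0 = 0 ∧ c 1 = 0
  · have : ((Finset.range (2 ^ l) ×ˢ Finset.range (2 ^ l)).filter (crossing l c)) = ∅ := by
      apply Finset.filter_eq_empty_iff.mpr
      rintro p - ⟨⟨U, V, -, -, -, -, h⟩, ⟨U', V', -, -, -, -, h'⟩⟩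
      rw [h0.1, h0.2] at h h'
      linarith
    rw [this]; simp
  rcases le_total |c 0| |c 1| with hab | hab
  · have hb : c 1 ≠ 0 := by
      intro h
      rw [h, abs_zero] at hab
      exact h0 ⟨abs_eq_zero.mp (le_antisymm hab (abs_nonneg _)), h⟩
    apply count_aux (2 ^ l) (c 0 / c 1) (c 2 * 2 ^ l / c 1)
    intro p hp
    obtain ⟨hp1, ⟨U, V, a1, a2, a3, a4, hn⟩, ⟨U', V', b1, b2, b3, b4, hp⟩⟩ := Finset.mem_filter.mp hp
    refine ⟨Finset.mem_range.mp (Finset.mem_product.mp hp1).1, ?_⟩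
    exact cross_aux2 _ _ _ hab hb U V U' V' _ _ a1 a2 a3 a4 b1 b2 b3 b4 hn hp
  · have hb : c 0 ≠ 0 := by
      intro h
      rw [h, abs_zero] at hab
      exact h0 ⟨h, abs_eq_zero.mp (le_antisymm hab (abs_nonneg _))⟩
    rw [← Finset.card_image_of_injective _ Prod.swap_injective]
    apply count_aux (2 ^ l) (c 1 / c 0) (c 2 * 2 ^ l / c 0)
    intro p hp
    obtain ⟨p', hp', rfl⟩ := Finset.mem_image.mp hp
    obtain ⟨hp1, ⟨U, V, a1, a2, a3, a4, hn⟩, ⟨U', V', b1, b2, b3, b4, hp⟩⟩ := Finset.mem_filter.mp hp'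
    refine ⟨Finset.mem_range.mp (Finset.mem_product.mp hp1).2, ?_⟩
    exact cross_aux2 _ _ _ hab hb V U V' U' _ _ a3 a4 a1 a2 b3 b4 b1 b2 (by linarith) (by linarith)

/-- net of coefficient vectors -/
noncomputable def netG (k : ℕ) : Finset (Fin 3 → ℤ) :=
  Finset.univ.biUnion fun a : Fin 3 => Fintype.piFinset
    (fun b => if b = a then {(2 : ℤ) ^ k} else Finset.Icc (-2 ^ k) (2 ^ k))

lemma netG_card (k : ℕ) : (netG k).card ≤ 27 * 4 ^ k := by
  unfold netG
  refine Finset.card_biUnion_le.trans ?_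
  have h1 : ∀ a : Fin 3, (Fintype.piFinset
    (fun b => if b = a then {(2 : ℤ) ^ k} else Finset.Icc (-2 ^ k) (2 ^ k))).card = (2 * 2 ^ k + 1) ^ 2 := by
    intro a
    have hc : (Finset.Icc (-2 ^ k : ℤ) (2 ^ k)).card = 2 * 2 ^ k + 1 := by
      rw [Int.card_Icc]
      have : ((2 : ℤ) ^ k) = ((2 ^ k : ℕ) : ℤ) := by push_cast; rfl
      omega
    rw [Fintype.card_piFinset, Fin.prod_univ_three]
    fin_cases a <;> simp [hc] <;> ring
  rw [Finset.sum_congr rfl (fun a _ => h1 a)]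
  simp only [Finset.sum_const, Finset.card_univ, Fintype.card_fin, smul_eq_mul]
  have h2 : (4 : ℕ) ^ k = (2 ^ k) ^ 2 := by rw [← pow_mul, mul_comm, pow_mul]; norm_num
  rw [h2]
  have h3 : 1 ≤ 2 ^ k := Nat.one_le_two_pow
  nlinarith

lemma netG_mem_abs {k : ℕ} {z : Fin 3 → ℤ} (hz : z ∈ netG k) (b : Fin 3) : |(z b : ℝ)| ≤ 2 ^ k := by
  simp only [netG, Finset.mem_biUnion, Finset.mem_univ, true_and, Fintype.mem_piFinset] at hz
  obtain ⟨a, ha⟩ := hz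
  have := ha b
  have h2 : z b ∈ Finset.Icc (-2 ^ k : ℤ) (2 ^ k) := by
    split_ifs at this
    · rw [Finset.mem_singleton] at this
      rw [this, Finset.mem_Icc]
      have : (0 : ℤ) < 2 ^ k := by positivity
      constructor <;> linarith
    · exact this
  rw [Finset.mem_Icc] at h2
  rw [abs_le]
  exact_mod_cast h2

/-- rescaled net point -/
noncomputable def zc (k : ℕ) (z : Fin 3 → ℤ) : Fin 3 → ℝ := fun a => (z a : ℝ) / 2 ^ k

/-- floor rounding to the net -/
noncomputable def rnd (k : ℕ) (c : Fin 3 → ℝ) : Fin 3 → ℤ := fun a => ⌊2 ^ k * c a⌋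

lemma rnd_mem (k : ℕ) (c : Fin 3 → ℝ) (hc : ∀ a, |c a| ≤ 1) (a : Fin 3) (ha : c a = 1) :
    rnd k c ∈ netG k := by
  simp only [netG, Finset.mem_biUnion, Finset.mem_univ, true_and, Fintype.mem_piFinset]
  refine ⟨a, fun b => ?_⟩
  have e : (2 : ℝ) ^ k = ((2 ^ k : ℤ) : ℝ) := by push_cast; rfl
  split_ifs with h
  · subst h
    rw [Finset.mem_singleton, rnd, ha, mul_one, e, Int.floor_intCast]
  · obtain ⟨h1, h2⟩ := abs_le.mp (hc b)
    rw [Finset.mem_Icc, rnd]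
    have hp : (0 : ℝ) < 2 ^ k := by positivity
    constructor
    · rw [Int.le_floor]; push_cast; nlinarith
    · have : ((⌊2 ^ k * c b⌋ : ℤ) : ℝ) ≤ ((2 ^ k : ℤ) : ℝ) := by
        refine (Int.floor_le _).trans ?_
        push_cast; nlinarith
      exact_mod_cast this

lemma rnd_succ (k : ℕ) (c : Fin 3 → ℝ) : rnd k c = fun a => rnd (k + 1) c a / 2 := by
  ext a
  simp only [rnd]
  have h := Int.floor_div_natCast (2 ^ (k + 1) * c a) 2
  rw [← Nat.cast_ofNat (R := ℤ) (n := 2)]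
  rw [← h]
  congr 1
  rw [pow_succ]; push_cast; ring

lemma linF_diff (c c' : Fin 3 → ℝ) (e u v : ℝ) (h : ∀ a, |c a - c' a| ≤ e) (hu : 0 ≤ u) (hu1 : u ≤ 1)
    (hv : 0 ≤ v) (hv1 : v ≤ 1) : |(|linF c u v| - |linF c' u v|)| ≤ 3 * e := by
  refine (abs_abs_sub_abs_le_abs_sub _ _).trans ?_
  have e0 : linF c u v - linF c' u v = (c 0 - c' 0) * u + (c 1 - c' 1) * v + (c 2 - c' 2) := by
    unfold linF; ring
  rw [e0]
  refine (abs_add_le _ _).trans ?_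
  have h1 := abs_add_le ((c 0 - c' 0) * u) ((c 1 - c' 1) * v)
  rw [abs_mul, abs_mul, abs_of_nonneg hu, abs_of_nonneg hv] at h1
  have h2 : |c 0 - c' 0| * u ≤ e := by nlinarith [h 0, abs_nonneg (c 0 - c' 0)]
  have h3 : |c 1 - c' 1| * v ≤ e := by nlinarith [h 1, abs_nonneg (c 1 - c' 1)]
  linarith [h 2]

lemma rnd_close (k : ℕ) (c : Fin 3 → ℝ) (a : Fin 3) : |c a - zc k (rnd k c) a| ≤ 1 / 2 ^ k := by
  simp only [zc, rnd]
  have hp : (0 : ℝ) < 2 ^ k := by positivity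
  have h1 := Int.floor_le (2 ^ k * c a)
  have h2 := Int.lt_floor_add_one (2 ^ k * c a)
  have e : c a - (⌊2 ^ k * c a⌋ : ℝ) / 2 ^ k = (2 ^ k * c a - ⌊2 ^ k * c a⌋) / 2 ^ k := by
    field_simp
  rw [e, abs_div, abs_of_pos hp, abs_of_nonneg (by linarith)]
  gcongr
  linarith

lemma half_close (k : ℕ) (z : Fin 3 → ℤ) (a : Fin 3) :
    |zc (k + 1) z a - zc k (fun a => z a / 2) a| ≤ 1 / 2 ^ (k + 1) := by
  simp only [zc]
  have hp : (0 : ℝ) < 2 ^ k := by positivity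
  have h1 : (z a : ℤ) - 2 * (z a / 2) = 0 ∨ z a - 2 * (z a / 2) = 1 := by omega
  have e : (z a : ℝ) / 2 ^ (k + 1) - ((z a / 2 : ℤ) : ℝ) / 2 ^ k
      = ((z a - 2 * (z a / 2) : ℤ) : ℝ) / 2 ^ (k + 1) := by
    push_cast [pow_succ]; field_simp
  rw [e, abs_div, abs_of_pos (by positivity : (0 : ℝ) < 2 ^ (k + 1))]
  gcongr
  rcases h1 with h | h <;> rw [h] <;> norm_num

lemma cell_bounds (l : ℕ) (u : ℝ) (hu : 0 ≤ u) :
    ((⌊2 ^ l * u⌋₊ : ℕ) : ℝ) ≤ 2 ^ l * u ∧ 2 ^ l * u < (⌊2 ^ l * u⌋₊ : ℕ) + 1 :=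
  ⟨Nat.floor_le (by positivity), Nat.lt_floor_add_one _⟩

lemma linF_scale (l : ℕ) (c : Fin 3 → ℝ) (u v : ℝ) :
    c 0 * (2 ^ l * u) + c 1 * (2 ^ l * v) + c 2 * 2 ^ l = 2 ^ l * linF c u v := by
  unfold linF; ring

lemma linF_noncross (l : ℕ) (c : Fin 3 → ℝ) (k : ℕ × ℕ) (h : ¬ crossing l c k) :
    ∃ t : ℝ, ∀ u v : ℝ, 0 ≤ u → 0 ≤ v → cellL l u v = k → |linF c u v| = t * linF c u v := by
  have hp : (0 : ℝ) < 2 ^ l := by positivity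
  unfold crossing at h
  rw [not_and_or] at h
  rcases h with h | h
  · refine ⟨1, fun u v hu hv hk => ?_⟩
    subst hk
    rw [one_mul]
    apply abs_of_nonneg
    by_contra hneg
    push Not at hneg
    apply h
    refine ⟨2 ^ l * u, 2 ^ l * v, (cell_bounds l u hu).1, (cell_bounds l u hu).2,
      (cell_bounds l v hv).1, (cell_bounds l v hv).2, ?_⟩
    rw [linF_scale]
    exact mul_neg_of_pos_of_neg hp hneg
  · refine ⟨-1, fun u v hu hv hk => ?_⟩
    subst hk
    rw [neg_one_mul]
    apply abs_of_nonpos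
    by_contra hneg
    push Not at hneg
    apply h
    refine ⟨2 ^ l * u, 2 ^ l * v, (cell_bounds l u hu).1, (cell_bounds l u hu).2,
      (cell_bounds l v hv).1, (cell_bounds l v hv).2, ?_⟩
    rw [linF_scale]
    exact mul_pos hp hneg

lemma linF_cross (l : ℕ) (c : Fin 3 → ℝ) (hc : ∀ a, |c a| ≤ 1) (u v : ℝ) (hu : 0 ≤ u) (hv : 0 ≤ v)
    (h : crossing l c (cellL l u v)) : |linF c u v| ≤ 2 / 2 ^ l := by
  have hp : (0 : ℝ) < 2 ^ l := by positivity
  obtain ⟨⟨U, V, a1, a2, a3, a4, hn⟩, ⟨U', V', b1, b2, b3, b4, hp'⟩⟩ := h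
  obtain ⟨u1, u2⟩ := cell_bounds l u hu
  obtain ⟨v1, v2⟩ := cell_bounds l v hv
  simp only [cellL] at a1 a2 a3 a4 b1 b2 b3 b4
  rw [le_div_iff₀ hp, ← abs_of_pos hp, ← abs_mul, mul_comm, ← linF_scale]
  have key : ∀ a x y : ℝ, |a| ≤ 1 → |x - y| ≤ 1 → a * x - a * y ≤ 1 := by
    intro a x y h1 h2
    rw [← mul_sub]
    refine (le_abs_self _).trans ?_
    rw [abs_mul]
    nlinarith [abs_nonneg a, abs_nonneg (x - y)]
  have d1 := key (c 0) (2 ^ l * u) U (hc 0) (by rw [abs_le]; constructor <;> linarith)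
  have d2 := key (c 1) (2 ^ l * v) V (hc 1) (by rw [abs_le]; constructor <;> linarith)
  have d3 := key (c 0) U' (2 ^ l * u) (hc 0) (by rw [abs_le]; constructor <;> linarith)
  have d4 := key (c 1) V' (2 ^ l * v) (hc 1) (by rw [abs_le]; constructor <;> linarith)
  rw [abs_le]
  constructor <;> linarith


lemma cost_sum (l n : ℕ) :
    ∑ k ∈ Finset.range n, (27 * 4 ^ (l + k) : ℝ) * (6 * Real.exp (-(6 + 2 * (k : ℝ)) ^ 2 / 4)) ≤ 4 ^ l := by
  have he1 : Real.exp (-1) ≤ 1 / 2 := by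
    rw [Real.exp_neg, ← one_div]
    apply one_div_le_one_div_of_le (by norm_num)
    linarith [Real.add_one_le_exp (1 : ℝ)]
  have h1 : ∀ k : ℕ, (27 * 4 ^ (l + k) : ℝ) * (6 * Real.exp (-(6 + 2 * (k : ℝ)) ^ 2 / 4))
      ≤ 4 ^ l * (1 / 2) * (1 / 2) ^ k := by
    intro k
    have e1 : Real.exp (-(6 + 2 * (k : ℝ)) ^ 2 / 4) ≤ Real.exp ((9 + 6 * k : ℕ) * (-1)) := by
      apply Real.exp_le_exp.mpr
      push_cast
      nlinarith [sq_nonneg (k : ℝ)]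
    rw [Real.exp_nat_mul] at e1
    have e2 : Real.exp (-1) ^ (9 + 6 * k) ≤ (1 / 2) ^ (9 + 6 * k) :=
      pow_le_pow_left₀ (Real.exp_pos _).le he1 _
    have e3 : (1 / 2 : ℝ) ^ (9 + 6 * k) = 1 / 512 * (1 / 64) ^ k := by
      rw [pow_add, pow_mul]; norm_num
    rw [e3] at e2
    calc (27 * 4 ^ (l + k) : ℝ) * (6 * Real.exp (-(6 + 2 * (k : ℝ)) ^ 2 / 4))
        ≤ (27 * 4 ^ (l + k) : ℝ) * (6 * (1 / 512 * (1 / 64) ^ k)) := by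
          gcongr; exact e1.trans e2
      _ = 4 ^ l * (162 / 512) * (4 * (1 / 64)) ^ k := by rw [pow_add, mul_pow]; ring
      _ = 4 ^ l * (162 / 512) * (1 / 16) ^ k := by norm_num
      _ ≤ 4 ^ l * (1 / 2) * (1 / 2) ^ k :=
          mul_le_mul (mul_le_mul_of_nonneg_left (by norm_num) (by positivity))
            (pow_le_pow_left₀ (by norm_num) (by norm_num) k) (by positivity) (by positivity)
  calc _ ≤ ∑ k ∈ Finset.range n, (4 : ℝ) ^ l * (1 / 2) * (1 / 2) ^ k :=
        Finset.sum_le_sum fun k _ => h1 k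
    _ = 4 ^ l * (1 / 2) * ∑ k ∈ Finset.range n, (1 / 2 : ℝ) ^ k := by rw [Finset.mul_sum]
    _ ≤ 4 ^ l * (1 / 2) * 2 := by
        gcongr
        exact sum_geometric_two_le n
    _ = 4 ^ l := by ring

lemma cellL_coarse (l l' : ℕ) (h : l' ≤ l) (u v : ℝ) :
    cellL l' u v = ((cellL l u v).1 / 2 ^ (l - l'), (cellL l u v).2 / 2 ^ (l - l')) := by
  have key : ∀ x : ℝ, ⌊2 ^ l' * x⌋₊ = ⌊2 ^ l * x⌋₊ / 2 ^ (l - l') := by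
    intro x
    rw [← Nat.floor_div_natCast]
    congr 1
    have : (2 : ℝ) ^ l = 2 ^ l' * 2 ^ (l - l') := by rw [← pow_add]; congr 1; omega
    rw [this]
    push_cast
    field_simp
  simp only [cellL, key]

lemma eta8 (l : ℕ) : (1 : ℝ) / 2 ^ (3 * l) ≤ etaC ^ l := by
  rw [pow_mul]
  calc (1 : ℝ) / (2 ^ 3) ^ l = (1 / 8) ^ l := by rw [one_div_pow]; norm_num
    _ ≤ etaC ^ l := pow_le_pow_left₀ (by norm_num) etaC_ge l

lemma var_arith (l : ℕ) (B : ℝ) (m : ℕ) (_h : (0 : ℝ) < 2 ^ m) :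
    (3 / (2 : ℝ) ^ (l + m)) ^ 2 * (6 * 2 ^ l * (B / 4 ^ l) ^ 2) ≤ (8 * B * etaC ^ l / 2 ^ m) ^ 2 := by
  have e1 : (8 * B * etaC ^ l / 2 ^ m) ^ 2 = 64 * B ^ 2 * ((etaC ^ 2) ^ l / (2 ^ m) ^ 2) := by
    rw [← pow_mul, mul_comm 2 l, pow_mul]; ring
  have e32 : (32 : ℝ) ^ l = (2 ^ l) ^ 5 := by rw [← pow_mul, mul_comm, pow_mul]; norm_num
  have e4 : (4 : ℝ) ^ l = (2 ^ l) ^ 2 := by rw [← pow_mul, mul_comm, pow_mul]; norm_num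
  rw [e1, etaC_sq, one_div_pow, e32, e4, pow_add]
  have e2 : (3 / ((2 : ℝ) ^ l * 2 ^ m)) ^ 2 * (6 * 2 ^ l * (B / (2 ^ l) ^ 2) ^ 2)
      = 54 * B ^ 2 * (1 / (2 ^ l) ^ 5 / (2 ^ m) ^ 2) := by
    field_simp; ring
  rw [e2]
  gcongr
  norm_num

set_option maxHeartbeats 2000000 in
open Classical in
lemma step_normalized {ι : Type*} [Fintype ι] [DecidableEq ι] (u v ν w : ι → ℝ) (l : ℕ) (B : ℝ) (hB : 0 < B)
    (hu : ∀ i, 0 ≤ u i ∧ u i < 1) (hv : ∀ i, 0 ≤ v i ∧ v i < 1) (hw : ∀ i, 0 ≤ w i)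
    (hm : ∀ l' ≤ l, ∀ k, ∑ i with cellL l' (u i) (v i) = k, w i ≤ B / 4 ^ l')
    (hN : 104 * 4 ^ l < (Finset.univ.filter (fun i => w i ≠ 0)).card) :
    ∃ w' : ι → ℝ, (∀ i, 0 ≤ w' i) ∧
      (Finset.univ.filter (fun i => w' i ≠ 0)).card + 4 ^ l
        ≤ (Finset.univ.filter (fun i => w i ≠ 0)).card ∧
      (∀ l' ≤ l, ∀ k, ∑ i with cellL l' (u i) (v i) = k, w' i ≤ B / 4 ^ l') ∧
      (∑ i, w' i * ν i = ∑ i, w i * ν i) ∧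
      ∀ c : Fin 3 → ℝ, (∀ a, |c a| ≤ 1) → (∃ a, c a = 1) →
        |∑ i, (w' i - w i) * abs (linF c (u i) (v i))| ≤ 131 * B * etaC ^ l := by
  set K : Finset (ℕ × ℕ) := Finset.range (2 ^ l) ×ˢ Finset.range (2 ^ l) with hKdef
  have hKc : K.card = 4 ^ l := by
    rw [hKdef, Finset.card_product, Finset.card_range, ← mul_pow]; norm_num
  have hKne : K.Nonempty := Finset.card_pos.mp (by rw [hKc]; positivity)
  let f : ι → ℕ × ℕ := fun i => cellL l (u i) (v i)
  have hf : ∀ i, f i ∈ K := by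
    intro i
    have key : ∀ x : ℝ, 0 ≤ x → x < 1 → ⌊2 ^ l * x⌋₊ < 2 ^ l := by
      intro x h0 h1
      rw [Nat.floor_lt (by positivity)]
      push_cast
      have : (0 : ℝ) < 2 ^ l := by positivity
      nlinarith
    rw [hKdef, Finset.mem_product, Finset.mem_range, Finset.mem_range]
    exact ⟨key _ (hu i).1 (hu i).2, key _ (hv i).1 (hv i).2⟩
  let q : ι → Fin 4 → ℝ := fun i => ![1, u i, v i, ν i]
  let par : ℕ → (Fin 3 → ℤ) → Fin 3 → ℝ := fun k z => zc (l + k - 1) (fun a => z a / 2)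
  let J := Σ k : Fin (2 * l + 1), (netG (l + k.1) : Finset (Fin 3 → ℤ))
  let F : J → ι → ℝ := fun j i => |linF (zc (l + j.1.1) j.2.1) (u i) (v i)| -
    (if j.1.1 = 0 then 0 else |linF (par j.1.1 j.2.1) (u i) (v i)|)
  let Bad : J → Finset (ℕ × ℕ) := fun j => K.filter (crossing l (zc (l + j.1.1) j.2.1)) ∪
    (if j.1.1 = 0 then ∅ else K.filter (crossing l (par j.1.1 j.2.1)))
  let δ : J → ℝ := fun j => 3 / 2 ^ (l + j.1.1)
  let s : J → ℝ := fun j => 8 * B * etaC ^ l / 2 ^ j.1.1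
  let lam : J → ℝ := fun j => 6 + 2 * (j.1.1 : ℝ)
  have hη := etaC_pos
  have hzc1 : ∀ j : J, ∀ a, |zc (l + j.1.1) j.2.1 a| ≤ 1 := by
    intro j a
    simp only [zc]
    rw [abs_div, abs_of_pos (by positivity : (0 : ℝ) < 2 ^ (l + j.1.1)), div_le_one (by positivity)]
    exact netG_mem_abs j.2.2 a
  have haff : ∀ (c : Fin 3 → ℝ) (k : ℕ × ℕ), ¬ crossing l c k → ∃ t : Fin 4 → ℝ, ∀ i, f i = k →
      |linF c (u i) (v i)| = ∑ x, t x * q i x := by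
    intro c k hk
    obtain ⟨t, ht⟩ := linF_noncross l c k hk
    refine ⟨![t * c 2, t * c 0, t * c 1, 0], fun i hi => ?_⟩
    rw [ht (u i) (v i) (hu i).1 (hv i).1 hi]
    simp only [q, Fin.sum_univ_four, linF]
    simp
    ring
  have hcardBad : ∀ j, ((Bad j).card : ℝ) ≤ 6 * 2 ^ l := by
    intro j
    have h1 : (Bad j).card ≤ 3 * 2 ^ l + 3 * 2 ^ l := by
      refine (Finset.card_union_le _ _).trans (add_le_add (cross_count _ _) ?_)
      split_ifs
      · simp
      · exact cross_count _ _
    have : ((Bad j).card : ℝ) ≤ ((3 * 2 ^ l + 3 * 2 ^ l : ℕ) : ℝ) := by exact_mod_cast h1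
    push_cast at this
    linarith
  have hFd : ∀ (j : J) i, j.1.1 ≠ 0 → |F j i| ≤ δ j := by
    intro j i h0
    simp only [F, h0, if_false, δ, par]
    obtain ⟨k, hk⟩ : ∃ k, l + j.1.1 = k + 1 := ⟨l + j.1.1 - 1, by omega⟩
    generalize (j.2.1 : Fin 3 → ℤ) = z
    rw [hk, Nat.add_sub_cancel, div_eq_mul_one_div]
    exact linF_diff _ _ _ _ _ (half_close k z) (hu i).1 (hu i).2.le (hv i).1 (hv i).2.le
  have hgood : ∀ j k, k ∉ Bad j → ∃ t : Fin 4 → ℝ, ∀ i, f i = k → F j i = ∑ x, t x * q i x := by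
    -- good
    intro j k hk
    simp only [Bad, Finset.mem_union, not_or] at hk
    by_cases hkK : k ∈ K
    · have hk1 : ¬ crossing l (zc (l + j.1.1) j.2.1) k := fun h => hk.1 (Finset.mem_filter.mpr ⟨hkK, h⟩)
      obtain ⟨t1, ht1⟩ := haff _ k hk1
      by_cases h0 : j.1.1 = 0
      · refine ⟨t1, fun i hi => ?_⟩
        simp only [F]
        rw [if_pos h0, sub_zero]
        exact ht1 i hi
      · have hk2 : ¬ crossing l (par j.1.1 j.2.1) k := by
          intro h
          apply hk.2
          rw [if_neg h0]
          exact Finset.mem_filter.mpr ⟨hkK, h⟩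
        obtain ⟨t2, ht2⟩ := haff _ k hk2
        refine ⟨fun x => t1 x - t2 x, fun i hi => ?_⟩
        simp only [F, if_neg h0, sub_mul, Finset.sum_sub_distrib]
        rw [ht1 i hi, ht2 i hi]
    · exact ⟨0, fun i hi => absurd (hi ▸ hf i) hkK⟩
  have hbad : ∀ j i, f i ∈ Bad j → |F j i| ≤ δ j := by
    -- bad
    intro j i hi
    by_cases h0 : j.1.1 = 0
    · simp only [Bad] at hi
      rw [if_pos h0, Finset.union_empty, Finset.mem_filter] at hi
      simp only [F, δ]
      rw [if_pos h0, sub_zero, abs_abs]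
      refine (linF_cross l _ (hzc1 j) _ _ (hu i).1 (hv i).1 hi.2).trans ?_
      have hl0 : l + j.1.1 = l := by omega
      rw [hl0]
      exact div_le_div_of_nonneg_right (by norm_num) (by positivity)
    · exact hFd j i h0
  have hδ : ∀ j, 0 ≤ δ j := by
    intro j; positivity
  have hs : ∀ j, 0 < s j := by
    intro j; simp only [s]; positivity
  have hlam : ∀ j, 2 ≤ lam j := by
    intro j
    simp only [lam]
    have : (0 : ℝ) ≤ (j.1.1 : ℝ) := Nat.cast_nonneg _
    linarith
  have hvar : ∀ j, δ j ^ 2 * ((Bad j).card * (B / 4 ^ l) ^ 2) ≤ s j ^ 2 := by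
    intro j
    calc δ j ^ 2 * ((Bad j).card * (B / 4 ^ l) ^ 2) ≤ δ j ^ 2 * ((6 * 2 ^ l) * (B / 4 ^ l) ^ 2) := by
          gcongr; exact hcardBad j
      _ ≤ s j ^ 2 := by
          simp only [δ, s]
          exact var_arith l B _ (by positivity)
  have hcost : ∑ j, 6 * Real.exp (-(lam j) ^ 2 / 4) ≤ (K.card : ℝ) := by
    rw [hKc]
    push_cast
    refine le_trans ?_ (cost_sum l (2 * l + 1))
    rw [Fintype.sum_sigma, Finset.sum_range]
    apply Finset.sum_le_sum
    intro k _
    simp only [lam, Finset.sum_const, Finset.card_univ, Fintype.card_coe, nsmul_eq_mul]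
    have : ((netG (l + k.1)).card : ℝ) ≤ 27 * 4 ^ (l + k.1) := by exact_mod_cast netG_card (l + k.1)
    gcongr
  obtain ⟨w', h1, h2, h3, h4, h5⟩ := abstract_step f K hKne hf q w hw (B / 4 ^ l) (hm l le_rfl)
    F Bad δ s lam hgood hbad hδ hs hlam hvar hcost (by rw [hKc]; exact hN)
  have hcell : ∀ k, ∑ i with f i = k, w' i = ∑ i with f i = k, w i := by
    intro k
    have := h4 k 0
    simpa [q] using this
  have htot : ∀ (P : ℕ × ℕ → Prop) [DecidablePred P], ∑ i with P (f i), w' i = ∑ i with P (f i), w i := by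
    intro P _
    have key : ∀ W : ι → ℝ, ∑ i with P (f i), W i = ∑ k ∈ K.filter P, ∑ i with f i = k, W i := by
      intro W
      rw [← Finset.sum_fiberwise_of_maps_to (s := Finset.univ.filter (fun i => P (f i))) (g := f)
        (t := K.filter P)]
      · apply Finset.sum_congr rfl
        intro k hk
        apply Finset.sum_congr _ (fun _ _ => rfl)
        ext i
        simp only [Finset.mem_filter, Finset.mem_univ, true_and]
        constructor
        · exact fun h => h.2
        · intro h; exact ⟨by rw [h]; exact (Finset.mem_filter.mp hk).2, h⟩
      · intro i hi
        exact Finset.mem_filter.mpr ⟨hf i, (Finset.mem_filter.mp hi).2⟩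
    rw [key, key]
    exact Finset.sum_congr rfl fun k _ => hcell k
  refine ⟨w', h1, by rw [hKc] at h3; exact h3, ?_, ?_, ?_⟩
  · intro l' hl' k
    refine le_trans (le_of_eq ?_) (hm l' hl' k)
    have := htot (fun k0 => ((k0.1 / 2 ^ (l - l'), k0.2 / 2 ^ (l - l')) : ℕ × ℕ) = k)
    simp only [f] at this
    simp only [cellL_coarse l l' hl']
    exact this
  · have key : ∀ W : ι → ℝ, ∑ i, W i = ∑ k ∈ K, ∑ i with f i = k, W i := fun W =>
      (Finset.sum_fiberwise_of_maps_to (fun i _ => hf i) W).symm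
    rw [key, key]
    apply Finset.sum_congr rfl
    intro k _
    have := h4 k 3
    simpa [q] using this
  · rintro c hc ⟨a, ha⟩
    have hsum : ∀ k, k ≤ 2 * l → |∑ i, (w' i - w i) * abs (linF (zc (l + k) (rnd (l + k) c)) (u i) (v i))|
        ≤ 8 * B * etaC ^ l * (16 - (2 * k + 10) / 2 ^ k) := by
      intro k
      induction k with
      | zero =>
        intro _
        have := h5 ⟨⟨0, by omega⟩, ⟨rnd (l + 0) c, rnd_mem _ c hc a ha⟩⟩
        simp only [F, s, lam, if_true, sub_zero] at this
        refine this.trans (le_of_eq ?_)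
        norm_num
        ring
      | succ k ih =>
        intro hk
        have i1 := ih (by omega)
        have i2 := h5 ⟨⟨k + 1, by omega⟩, ⟨rnd (l + (k + 1)) c, rnd_mem _ c hc a ha⟩⟩
        have hpar : par (k + 1) (rnd (l + (k + 1)) c) = zc (l + k) (rnd (l + k) c) := by
          simp only [par]
          rw [rnd_succ (l + k) c]
          rfl
        simp only [F, s, lam, hpar] at i2
        have hk0 : (k + 1 = 0) = False := by simp
        simp only [hk0, if_false] at i2
        simp only [mul_sub, Finset.sum_sub_distrib] at i2
        have e : 8 * B * etaC ^ l * (16 - (2 * ((k + 1 : ℕ) : ℝ) + 10) / 2 ^ (k + 1))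
            = 8 * B * etaC ^ l * (16 - (2 * k + 10) / 2 ^ k)
              + (6 + 2 * ((k + 1 : ℕ) : ℝ)) * (8 * B * etaC ^ l / 2 ^ (k + 1)) := by
          push_cast [pow_succ]
          field_simp
          ring
        rw [e]
        have := abs_sub_abs_le_abs_sub (∑ i, (w' i - w i) * |linF (zc (l + (k + 1)) (rnd (l + (k + 1)) c)) (u i) (v i)|)
          (∑ i, (w' i - w i) * |linF (zc (l + k) (rnd (l + k) c)) (u i) (v i)|)
        linarith
    have r1 := hsum (2 * l) le_rfl
    have r2 : |∑ i, (w' i - w i) * |linF c (u i) (v i)|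
        - ∑ i, (w' i - w i) * abs (linF (zc (l + 2 * l) (rnd (l + 2 * l) c)) (u i) (v i))|
        ≤ 3 * B * etaC ^ l := by
      rw [← Finset.sum_sub_distrib]
      have hB0 : ∑ i, w i ≤ B := by
        have := hm 0 (Nat.zero_le _) (0, 0)
        rw [pow_zero, div_one] at this
        refine le_trans (le_of_eq ?_) this
        apply Finset.sum_congr _ (fun _ _ => rfl)
        ext i
        simp only [Finset.mem_filter, Finset.mem_univ, true_and, true_iff, cellL, pow_zero, one_mul]
        rw [Nat.floor_eq_zero.mpr (hu i).2, Nat.floor_eq_zero.mpr (hv i).2]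
      calc _ ≤ ∑ i, w i * (3 * (1 / 2 ^ (l + 2 * l))) := by
            refine (Finset.abs_sum_le_sum_abs _ _).trans (Finset.sum_le_sum fun i _ => ?_)
            rw [← mul_sub, abs_mul]
            exact mul_le_mul (h2 i) (linF_diff _ _ _ _ _ (fun a => rnd_close _ c a) (hu i).1 (hu i).2.le
              (hv i).1 (hv i).2.le) (abs_nonneg _) (hw i)
        _ = (∑ i, w i) * (3 * (1 / 2 ^ (3 * l))) := by
            rw [← Finset.sum_mul]; congr 4; ring
        _ ≤ B * (3 * etaC ^ l) := by
            have := eta8 l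
            gcongr
        _ = _ := by ring
    have r3 := abs_sub_abs_le_abs_sub (∑ i, (w' i - w i) * |linF c (u i) (v i)|)
        (∑ i, (w' i - w i) * |linF (zc (l + 2 * l) (rnd (l + 2 * l) c)) (u i) (v i)|)
    have r4 : 8 * B * etaC ^ l * (16 - (2 * ((2 * l : ℕ) : ℝ) + 10) / 2 ^ (2 * l)) ≤ 8 * B * etaC ^ l * 16 := by
      apply mul_le_mul_of_nonneg_left _ (by positivity)
      have : 0 ≤ (2 * ((2 * l : ℕ) : ℝ) + 10) / 2 ^ (2 * l) := by positivity
      linarith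
    linarith


/-- the second weight is an admissible replacement of the first -/
def Red {ι : Type*} [Fintype ι] (u v ν w w' : ι → ℝ) (B : ℝ) (l : ℕ) (E : ℝ) : Prop :=
  (∀ i, 0 ≤ w' i) ∧ (∀ l' ≤ l, ∀ k, ∑ i with cellL l' (u i) (v i) = k, w' i ≤ B / 4 ^ l') ∧
  (∑ i, w' i * ν i = ∑ i, w i * ν i) ∧
  ∀ (c : Fin 3 → ℝ) (M : ℝ), (∀ a, |c a| ≤ M) →
    |∑ i, (w' i - w i) * abs (linF c (u i) (v i))| ≤ E * M

lemma Red.trans {ι : Type*} [Fintype ι] {u v ν w w' w'' : ι → ℝ} {B : ℝ} {l l' : ℕ} {E E' : ℝ}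
    (h : Red u v ν w w' B l E) (h' : Red u v ν w' w'' B l' E') : Red u v ν w w'' B l' (E + E') := by
  obtain ⟨_, _, a3, a4⟩ := h
  obtain ⟨b1, b2, b3, b4⟩ := h'
  refine ⟨b1, b2, b3.trans a3, fun c M hc => ?_⟩
  have e : ∑ i, (w'' i - w i) * abs (linF c (u i) (v i)) = ∑ i, (w' i - w i) * abs (linF c (u i) (v i))
      + ∑ i, (w'' i - w' i) * abs (linF c (u i) (v i)) := by
    rw [← Finset.sum_add_distrib]; apply Finset.sum_congr rfl; intros; ring
  rw [e, add_mul]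
  exact (abs_add_le _ _).trans (add_le_add (a4 c M hc) (b4 c M hc))

lemma step_red {ι : Type*} [Fintype ι] [DecidableEq ι] (u v ν w : ι → ℝ) (l : ℕ) (B : ℝ) (hB : 0 < B)
    (hu : ∀ i, 0 ≤ u i ∧ u i < 1) (hv : ∀ i, 0 ≤ v i ∧ v i < 1) (hw : ∀ i, 0 ≤ w i)
    (hm : ∀ l' ≤ l, ∀ k, ∑ i with cellL l' (u i) (v i) = k, w i ≤ B / 4 ^ l')
    (hN : 104 * 4 ^ l < (Finset.univ.filter (fun i => w i ≠ 0)).card) :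
    ∃ w' : ι → ℝ, Red u v ν w w' B l (131 * B * etaC ^ l) ∧
      (Finset.univ.filter (fun i => w' i ≠ 0)).card + 4 ^ l
        ≤ (Finset.univ.filter (fun i => w i ≠ 0)).card := by
  obtain ⟨w', h1, h2, h3, h4, h5⟩ := step_normalized u v ν w l B hB hu hv hw
    (fun l' hl' k => by convert hm l' hl' k) (by convert hN)
  refine ⟨w', ⟨h1, fun l' hl' k => by convert h3 l' hl' k, h4, ?_⟩, by convert h2⟩
  intro c M hc
  have hη := etaC_pos
  obtain ⟨a, -, ha⟩ := Finset.exists_max_image Finset.univ (fun a => |c a|) (Finset.univ_nonempty (α := Fin 3))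
  have hM0 : 0 ≤ M := (abs_nonneg _).trans (hc 0)
  by_cases h0 : c a = 0
  · have hz : ∀ b, c b = 0 := by
      intro b
      have := ha b (Finset.mem_univ _)
      rw [h0, abs_zero] at this
      exact abs_eq_zero.mp (le_antisymm this (abs_nonneg _))
    have : ∑ i, (w' i - w i) * abs (linF c (u i) (v i)) = 0 := by
      apply Finset.sum_eq_zero
      intro i _
      simp [linF, hz]
    rw [this, abs_zero]
    positivity
  · have hp : 0 < |c a| := abs_pos.mpr h0
    have h6 := h5 (fun b => c b / c a) (fun b => by
      rw [abs_div, div_le_one hp]; exact ha b (Finset.mem_univ _)) ⟨a, div_self h0⟩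
    have e : ∑ i, (w' i - w i) * abs (linF c (u i) (v i))
        = |c a| * ∑ i, (w' i - w i) * abs (linF (fun b => c b / c a) (u i) (v i)) := by
      rw [Finset.mul_sum]
      apply Finset.sum_congr rfl
      intro i _
      have : linF c (u i) (v i) = c a * linF (fun b => c b / c a) (u i) (v i) := by
        unfold linF; field_simp
      rw [this, abs_mul]; ring
    rw [e, abs_mul, abs_abs, mul_comm]
    exact mul_le_mul h6 (hc a) (abs_nonneg _) (by positivity)

lemma level_red {ι : Type*} [Fintype ι] [DecidableEq ι] (u v ν : ι → ℝ) (l : ℕ) (B : ℝ) (hB : 0 < B)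
    (hu : ∀ i, 0 ≤ u i ∧ u i < 1) (hv : ∀ i, 0 ≤ v i ∧ v i < 1) (n : ℕ) :
    ∀ w : ι → ℝ, (∀ i, 0 ≤ w i) →
    (∀ l' ≤ l, ∀ k, ∑ i with cellL l' (u i) (v i) = k, w i ≤ B / 4 ^ l') →
    (Finset.univ.filter (fun i => w i ≠ 0)).card ≤ 104 * 4 ^ l + n * 4 ^ l →
    ∃ w' : ι → ℝ, Red u v ν w w' B l (n * (131 * B * etaC ^ l)) ∧
      (Finset.univ.filter (fun i => w' i ≠ 0)).card ≤ 104 * 4 ^ l := by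
  have hη := etaC_pos
  have hrefl : ∀ (n : ℕ) (w : ι → ℝ), (∀ i, 0 ≤ w i) →
      (∀ l' ≤ l, ∀ k, ∑ i with cellL l' (u i) (v i) = k, w i ≤ B / 4 ^ l') →
      Red u v ν w w B l (n * (131 * B * etaC ^ l)) := by
    intro n w hw hm
    refine ⟨hw, hm, rfl, fun c M hc => ?_⟩
    have hM0 : 0 ≤ M := (abs_nonneg _).trans (hc 0)
    simp only [sub_self, zero_mul, Finset.sum_const_zero, abs_zero]
    positivity
  induction n with
  | zero =>
    intro w hw hm hN
    exact ⟨w, hrefl 0 w hw hm, by simpa using hN⟩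
  | succ n ih =>
    intro w hw hm hN
    by_cases h : (Finset.univ.filter (fun i => w i ≠ 0)).card ≤ 104 * 4 ^ l
    · exact ⟨w, hrefl _ w hw hm, h⟩
    · obtain ⟨w1, r1, c1⟩ := step_red u v ν w l B hB hu hv hw hm (not_le.mp h)
      obtain ⟨w2, r2, c2⟩ := ih w1 r1.1 r1.2.1 (by
        have e : (n + 1) * 4 ^ l = n * 4 ^ l + 4 ^ l := by ring
        rw [e] at hN; omega)
      refine ⟨w2, ?_, c2⟩
      have := r1.trans r2
      convert this using 1
      push_cast; ring

lemma multi_red {ι : Type*} [Fintype ι] [DecidableEq ι] (u v ν : ι → ℝ) (l0 : ℕ) (B : ℝ) (hB : 0 < B)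
    (hu : ∀ i, 0 ≤ u i ∧ u i < 1) (hv : ∀ i, 0 ≤ v i ∧ v i < 1) (d : ℕ) :
    ∀ w : ι → ℝ, (∀ i, 0 ≤ w i) →
    (∀ l' ≤ l0 + d, ∀ k, ∑ i with cellL l' (u i) (v i) = k, w i ≤ B / 4 ^ l') →
    (Finset.univ.filter (fun i => w i ≠ 0)).card ≤ 416 * 4 ^ (l0 + d) →
    ∃ w' : ι → ℝ, Red u v ν w w' B l0 (40872 * B * etaC ^ l0 * ∑ k ∈ Finset.range (d + 1), etaC ^ k) ∧
      (Finset.univ.filter (fun i => w' i ≠ 0)).card ≤ 104 * 4 ^ l0 := by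
  induction d with
  | zero =>
    intro w hw hm hN
    obtain ⟨w', r, c⟩ := level_red u v ν l0 B hB hu hv 312 w hw hm (by rw [add_zero] at hN; omega)
    refine ⟨w', ?_, c⟩
    convert r using 1
    simp; ring
  | succ d ih =>
    intro w hw hm hN
    obtain ⟨w1, r1, c1⟩ := level_red u v ν (l0 + (d + 1)) B hB hu hv 312 w hw hm (by omega)
    obtain ⟨w2, r2, c2⟩ := ih w1 r1.1 (fun l' hl' k => r1.2.1 l' (by omega) k) (by
      rw [← add_assoc, pow_succ] at c1; omega)
    refine ⟨w2, ?_, c2⟩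
    have := r1.trans r2
    convert this using 1
    rw [Finset.sum_range_succ _ (d + 1), pow_add]
    push_cast; ring

lemma planar_reduction {ι : Type*} [Fintype ι] [DecidableEq ι] (u v ν : ι → ℝ) (l0 L : ℕ) (hL : l0 ≤ L)
    (B : ℝ) (hB : 0 < B)
    (hu : ∀ i, 0 ≤ u i ∧ u i < 1) (hv : ∀ i, 0 ≤ v i ∧ v i < 1) 
    (w : ι → ℝ) (hw : ∀ i, 0 ≤ w i)
    (hm : ∀ l' ≤ L, ∀ k, ∑ i with cellL l' (u i) (v i) = k, w i ≤ B / 4 ^ l')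
    (hN : Fintype.card ι ≤ 416 * 4 ^ L) :
    ∃ w' : ι → ℝ, (∀ i, 0 ≤ w' i) ∧ (Finset.univ.filter (fun i => w' i ≠ 0)).card ≤ 104 * 4 ^ l0 ∧
      (∑ i, w' i * ν i = ∑ i, w i * ν i) ∧
      ∀ (c : Fin 3 → ℝ) (M : ℝ), (∀ a, |c a| ≤ M) →
        |∑ i, (w' i - w i) * abs (linF c (u i) (v i))| ≤ 81744 * B * etaC ^ l0 * M := by
  obtain ⟨d, rfl⟩ := Nat.exists_eq_add_of_le hL
  obtain ⟨w', r, c⟩ := multi_red u v ν l0 B hB hu hv d w hw hm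
    ((Finset.card_le_univ _).trans hN)
  refine ⟨w', r.1, c, r.2.2.1, fun c M hc => (r.2.2.2 c M hc).trans ?_⟩
  have hη := etaC_pos
  have hM0 : 0 ≤ M := (abs_nonneg _).trans (hc 0)
  apply mul_le_mul_of_nonneg_right _ hM0
  have h1 : ∑ k ∈ Finset.range (d + 1), etaC ^ k ≤ 2 :=
    (Finset.sum_le_sum fun k _ => pow_le_pow_left₀ hη.le etaC_lt.le k).trans (sum_geometric_two_le _)
  have h2 : 0 < B * etaC ^ l0 := by positivity
  nlinarith

section
open MeasureTheory

abbrev E3 := EuclideanSpace ℝ (Fin 3)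

noncomputable def rhoG (x : E3) : ℝ := Real.exp (-‖x‖ ^ 2)

lemma rhoG_pos (x : E3) : 0 < rhoG x := Real.exp_pos _

lemma int_norm_rho_aux (x : E3) : ‖x‖ * rhoG x = (fun t : ℝ => t * Real.exp (-t ^ 2)) ‖x‖ := rfl

lemma integrable_norm_rho : Integrable (fun x : E3 => ‖x‖ * rhoG x) := by
  have := (integrable_fun_norm_addHaar (E := E3) volume (f := fun t : ℝ => t * Real.exp (-t ^ 2))).1
  apply (integrable_fun_norm_addHaar (E := E3) volume (f := fun t : ℝ => t * Real.exp (-t ^ 2))).2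
  have h := (integrable_rpow_mul_exp_neg_mul_sq (b := 1) one_pos (s := 3) (by norm_num)).integrableOn (s := Set.Ioi (0:ℝ))
  refine h.congr_fun ?_ measurableSet_Ioi
  intro x hx
  have hx' : (0:ℝ) < x := hx
  simp only [finrank_euclideanSpace, Fintype.card_fin, smul_eq_mul]
  have : x ^ (3:ℝ) = x ^ 3 := by exact_mod_cast Real.rpow_natCast x 3
  rw [this]; simp; ring_nf

lemma integral_cube : ∫ y in Set.Ioi (0:ℝ), y ^ 3 * Real.exp (-y ^ 2) = 1 / 2 := by
  have h := integral_rpow_mul_exp_neg_rpow (p := 2) (q := 3) (by norm_num) (by norm_num)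
  have e : ∀ x : ℝ, x ^ (3:ℝ) * Real.exp (-x ^ (2:ℝ)) = x ^ 3 * Real.exp (-x ^ 2) := by
    intro x
    have h1 : x ^ (3:ℝ) = x ^ 3 := by exact_mod_cast Real.rpow_natCast x 3
    have h2 : x ^ (2:ℝ) = x ^ 2 := by exact_mod_cast Real.rpow_natCast x 2
    rw [h1, h2]
  simp only [e] at h
  rw [h]
  have : ((3:ℝ)+1)/2 = 2 := by norm_num
  rw [this]
  simp [Real.Gamma_two]

lemma integral_lin_gauss : ∫ y in Set.Ioi (0:ℝ), y * Real.exp (-y ^ 2) = 1 / 2 := by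
  have h := integral_rpow_mul_exp_neg_rpow (p := 2) (q := 1) (by norm_num) (by norm_num)
  have e : ∀ x : ℝ, x ^ (1:ℝ) * Real.exp (-x ^ (2:ℝ)) = x * Real.exp (-x ^ 2) := by
    intro x
    have h2 : x ^ (2:ℝ) = x ^ 2 := by exact_mod_cast Real.rpow_natCast x 2
    rw [Real.rpow_one, h2]
  simp only [e] at h
  rw [h]
  have : ((1:ℝ)+1)/2 = 1 := by norm_num
  rw [this]
  simp

lemma integral_norm_rho : ∫ x : E3, ‖x‖ * rhoG x = 2 * Real.pi := by
  have := integral_fun_norm_addHaar (E := E3) volume (f := fun t : ℝ => t * Real.exp (-t ^ 2))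
  simp only [int_norm_rho_aux]
  rw [this]
  have e : ∀ y : ℝ, y ^ (Module.finrank ℝ E3 - 1) • (y * Real.exp (-y ^ 2)) = y ^ 3 * Real.exp (-y ^ 2) := by
    intro y
    simp only [finrank_euclideanSpace, Fintype.card_fin, smul_eq_mul]
    ring_nf
  simp only [e, integral_cube]
  have hv : (volume : Measure E3).real (Metric.ball 0 1) = Real.pi * 4 / 3 := by
    rw [Measure.real, EuclideanSpace.volume_ball_fin_three]
    simp
    positivity
  rw [hv]
  simp
  ring

lemma integrable_inner_rho (c : E3) : Integrable (fun x : E3 => |⟪x, c⟫| * rhoG x) := by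
  refine (integrable_norm_rho.mul_const ‖c‖).mono' ?_ ?_
  · apply Continuous.aestronglyMeasurable
    unfold rhoG
    fun_prop
  · filter_upwards with x
    have := abs_real_inner_le_norm x c
    have h2 := (rhoG_pos x).le
    rw [Real.norm_eq_abs, abs_mul, abs_abs, abs_of_pos (rhoG_pos x)]
    nlinarith

lemma integral_inner_e0 : ∫ x : E3, |⟪x, EuclideanSpace.single (0 : Fin 3) (1:ℝ)⟫| * rhoG x = Real.pi := by
  rw [← (PiLp.volume_preserving_toLp (Fin 3)).integral_comp (MeasurableEquiv.toLp 2 _).measurableEmbedding]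
  let F : Fin 3 → ℝ → ℝ := ![fun t => |t| * Real.exp (-t^2), fun t => Real.exp (-t^2), fun t => Real.exp (-t^2)]
  have e : ∀ x : Fin 3 → ℝ, |⟪(WithLp.toLp 2 x : E3), EuclideanSpace.single (0 : Fin 3) (1:ℝ)⟫| * rhoG (WithLp.toLp 2 x) = ∏ i, F i (x i) := by
    intro x
    rw [Fin.prod_univ_three]
    have hi : ⟪(WithLp.toLp 2 x : E3), EuclideanSpace.single (0 : Fin 3) (1:ℝ)⟫ = x 0 := by
      rw [real_inner_comm, EuclideanSpace.inner_single_left]; simp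
    rw [hi]
    simp only [F, rhoG, EuclideanSpace.norm_sq_eq, Fin.sum_univ_three]
    simp [← Real.exp_add]
    rw [mul_assoc, mul_assoc, ← Real.exp_add, ← Real.exp_add]
    ring_nf
  simp only [e]
  rw [integral_fintype_prod_volume_eq_prod, Fin.prod_univ_three]
  have g : ∫ t : ℝ, Real.exp (-t^2) = √Real.pi := by
    have := integral_gaussian 1
    simpa using this
  have g0 : ∫ t : ℝ, |t| * Real.exp (-t^2) = 1 := by
    have := integral_comp_abs (f := fun t : ℝ => t * Real.exp (-t^2))
    simp only [sq_abs] at this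
    rw [this, integral_lin_gauss]; norm_num
  simp only [F, Matrix.cons_val]
  rw [g, g0, one_mul, Real.mul_self_sqrt Real.pi_pos.le]

lemma integral_inner_rho (c : E3) (hc : ‖c‖ = 1) : ∫ x : E3, |⟪x, c⟫| * rhoG x = Real.pi := by
  rw [← integral_inner_e0]
  set e : E3 := EuclideanSpace.single (0 : Fin 3) (1:ℝ)
  have he : ‖c‖ = ‖e‖ := by simp [hc, e]
  let T := (ℝ ∙ (c - e))ᗮ.reflection
  have hT : T c = e := Submodule.reflection_sub he
  rw [← (LinearIsometryEquiv.measurePreserving T).integral_comp T.toHomeomorph.measurableEmbedding (fun x => |⟪x, e⟫| * rhoG x)]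
  congr 1
  ext x
  rw [← hT, LinearIsometryEquiv.inner_map_map]
  simp [rhoG]

end

section
open MeasureTheory

open Classical in
noncomputable def faceOf (x : E3) : Fin 3 :=
  if |x 1| ≤ |x 0| ∧ |x 2| ≤ |x 0| then 0 else if |x 2| ≤ |x 1| then 1 else 2

lemma faceOf_le (x : E3) (b : Fin 3) : |x b| ≤ |x (faceOf x)| := by
  unfold faceOf
  by_cases h1 : |x 1| ≤ |x 0| ∧ |x 2| ≤ |x 0|
  · rw [if_pos h1]
    fin_cases b <;> simp [h1.1, h1.2]
  rw [if_neg h1]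
  by_cases h2 : |x 2| ≤ |x 1|
  · rw [if_pos h2]
    have : |x 0| ≤ |x 1| := by
      by_contra h
      exact h1 ⟨by linarith, by linarith⟩
    fin_cases b <;> simp [this, h2]
  · rw [if_neg h2]
    push Not at h2
    have : |x 0| ≤ |x 2| := by
      by_contra h
      exact h1 ⟨by linarith, by linarith⟩
    fin_cases b <;> simp [this, h2.le]

lemma mcoord (b : Fin 3) : Measurable (fun x : E3 => x b) := by
  apply Continuous.measurable
  fun_prop

lemma mcoord_div (a b : Fin 3) : Measurable (fun x : E3 => (x a / x b : ℝ)) :=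
  Measurable.div (G := ℝ) (mcoord a) (mcoord b)

lemma mcoord_abs (b : Fin 3) : Measurable (fun x : E3 => |x b|) := (mcoord b).abs

lemma measurable_faceOf : Measurable faceOf := by
  unfold faceOf
  refine Measurable.ite ?_ measurable_const (Measurable.ite ?_ measurable_const measurable_const)
  · exact (measurableSet_le (mcoord_abs 1) (mcoord_abs 0)).inter (measurableSet_le (mcoord_abs 2) (mcoord_abs 0))
  · exact measurableSet_le (mcoord_abs 2) (mcoord_abs 1)

noncomputable def coI (n : ℕ) [NeZero n] (t : ℝ) : Fin n :=
  ⟨min ⌊n * (1 + t) / 2⌋₊ (n - 1), by have := NeZero.pos n; omega⟩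

lemma measurable_coI (n : ℕ) [NeZero n] : Measurable (coI n) := by
  have h1 : Measurable (fun t : ℝ => ⌊n * (1 + t) / 2⌋₊) := Nat.measurable_floor.comp (by fun_prop)
  have h2 : Measurable (fun m : ℕ => (⟨min m (n - 1), by have := NeZero.pos n; omega⟩ : Fin n)) :=
    measurable_from_top
  exact h2.comp h1

lemma coI_spec (n : ℕ) [NeZero n] (t : ℝ) (ht : |t| ≤ 1) :
    |t - (2 * ((coI n t : ℕ) : ℝ) / n - 1)| ≤ 2 / n := by
  have hn : (0:ℝ) < n := by exact_mod_cast NeZero.pos n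
  obtain ⟨h1, h2⟩ := abs_le.1 ht
  set y : ℝ := n * (1 + t) / 2 with hy
  have hy0 : 0 ≤ y := by rw [hy]; apply div_nonneg (mul_nonneg hn.le (by linarith)) (by norm_num)
  have hyn : y ≤ n := by rw [hy]; nlinarith
  have hfl : (⌊y⌋₊ : ℝ) ≤ y := Nat.floor_le hy0
  have hfl2 : y < ⌊y⌋₊ + 1 := Nat.lt_floor_add_one y
  have hval : (coI n t : ℕ) = min ⌊y⌋₊ (n - 1) := rfl
  have hk : |y - ((coI n t : ℕ) : ℝ)| ≤ 1 := by
    rw [hval]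
    rcases le_total ⌊y⌋₊ (n - 1) with h | h
    · rw [min_eq_left h, abs_le]; constructor <;> linarith
    · rw [min_eq_right h]
      have h3 : ((n - 1 : ℕ) : ℝ) = n - 1 := by
        rw [Nat.cast_sub (NeZero.pos n)]; simp
      have h4 : ((n - 1 : ℕ) : ℝ) ≤ ⌊y⌋₊ := by exact_mod_cast h
      rw [abs_le]; constructor <;> linarith
  have e : t - (2 * ((coI n t : ℕ) : ℝ) / n - 1) = (2 / n) * (y - ((coI n t : ℕ) : ℝ)) := by
    rw [hy]; field_simp; ring
  rw [e, abs_mul, abs_of_pos (by positivity)]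
  have : (0:ℝ) < 2 / n := by positivity
  nlinarith

noncomputable def idxOf (n : ℕ) [NeZero n] (x : E3) : Fin 3 × (Fin n × Fin n) :=
  (faceOf x, (coI n (x ((faceOf x).succAbove 0) / x (faceOf x)), coI n (x ((faceOf x).succAbove 1) / x (faceOf x))))

lemma measurable_idxOf (n : ℕ) [NeZero n] : Measurable (idxOf n) := by
  have h : Measurable (fun p : Fin 3 × E3 => ((p.1, (coI n (p.2 (p.1.succAbove 0) / p.2 p.1),
      coI n (p.2 (p.1.succAbove 1) / p.2 p.1))) : Fin 3 × (Fin n × Fin n))) := by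
    apply measurable_from_prod_countable_right
    intro f
    refine Measurable.prodMk measurable_const (Measurable.prodMk ?_ ?_)
    · exact (measurable_coI n).comp (mcoord_div (f.succAbove 0) f)
    · exact (measurable_coI n).comp (mcoord_div (f.succAbove 1) f)
  exact h.comp (measurable_faceOf.prodMk measurable_id)

lemma measurable_sOf : Measurable (fun x : E3 => |x (faceOf x)|) := by
  have h : Measurable (fun p : Fin 3 × E3 => |p.2 p.1|) := by
    apply measurable_from_prod_countable_right
    intro f
    exact mcoord_abs f
  exact h.comp (measurable_faceOf.prodMk measurable_id)

noncomputable def gridP (n : ℕ) (k : Fin 3 × (Fin n × Fin n)) : E3 :=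
  WithLp.toLp 2 (Fin.insertNth (α := fun _ => ℝ) k.1 1 ![2 * ((k.2.1 : ℕ) : ℝ) / n - 1, 2 * ((k.2.2 : ℕ) : ℝ) / n - 1])

lemma gridP_same (n : ℕ) (k : Fin 3 × (Fin n × Fin n)) : gridP n k k.1 = 1 := by
  simp [gridP]

lemma gridP_zero (n : ℕ) (k : Fin 3 × (Fin n × Fin n)) : gridP n k (k.1.succAbove 0) = 2 * ((k.2.1 : ℕ) : ℝ) / n - 1 := by
  simp only [gridP, Fin.insertNth_apply_succAbove]; simp

lemma gridP_one (n : ℕ) (k : Fin 3 × (Fin n × Fin n)) : gridP n k (k.1.succAbove 1) = 2 * ((k.2.2 : ℕ) : ℝ) / n - 1 := by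
  simp only [gridP, Fin.insertNth_apply_succAbove]; simp

lemma ratio_abs_le (x : E3) (b : Fin 3) : |x b / x (faceOf x)| ≤ 1 := by
  rw [abs_div]
  exact div_le_one_of_le₀ (faceOf_le x b) (abs_nonneg _)

lemma ratio_mul (x : E3) (b : Fin 3) : x (faceOf x) * (x b / x (faceOf x)) = x b := by
  by_cases h : x (faceOf x) = 0
  · have := faceOf_le x b
    rw [h, abs_zero] at this
    have := abs_nonpos_iff.1 this
    rw [h, this]; simp
  · field_simp

lemma coord_close (n : ℕ) [NeZero n] (x : E3) (b : Fin 3) :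
    |x b - x (faceOf x) * gridP n (idxOf n x) b| ≤ |x (faceOf x)| * (2 / n) := by
  have hf : (idxOf n x).1 = faceOf x := rfl
  have hn : (0:ℝ) < n := by exact_mod_cast NeZero.pos n
  have key : ∀ c d : ℝ, x b = x (faceOf x) * c → |c - d| ≤ 2 / n →
      |x b - x (faceOf x) * d| ≤ |x (faceOf x)| * (2 / n) := by
    intro c d h1 h2
    rw [h1, ← mul_sub, abs_mul]
    exact mul_le_mul_of_nonneg_left h2 (abs_nonneg _)
  rcases Fin.eq_self_or_eq_succAbove (faceOf x) b with h | ⟨j, h⟩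
  · apply key 1
    · rw [h, mul_one]
    · rw [h, ← hf, gridP_same]; simp; positivity
  · apply key (x b / x (faceOf x)) _ (ratio_mul x b).symm
    fin_cases j
    · simp only [Fin.zero_eta] at h
      have e := gridP_zero n (idxOf n x)
      rw [hf, ← h] at e
      rw [e]
      have := coI_spec n _ (ratio_abs_le x b)
      rw [h] at this ⊢
      exact this
    · simp only [Fin.mk_one] at h
      have e := gridP_one n (idxOf n x)
      rw [hf, ← h] at e
      rw [e]
      have := coI_spec n _ (ratio_abs_le x b)
      rw [h] at this ⊢
      exact this

lemma sOf_le_norm (x : E3) : |x (faceOf x)| ≤ ‖x‖ := by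
  simpa using PiLp.norm_apply_le x (faceOf x)

lemma vec_close (n : ℕ) [NeZero n] (x : E3) :
    ‖x - x (faceOf x) • gridP n (idxOf n x)‖ ≤ ‖x‖ * (4 / n) := by
  have hn : (0:ℝ) < n := by exact_mod_cast NeZero.pos n
  have h := coord_close n x
  set D := |x (faceOf x)| * (2 / n) with hD
  have hD0 : 0 ≤ D := by positivity
  have hle : ‖x - x (faceOf x) • gridP n (idxOf n x)‖ ≤ 2 * D := by
    apply le_of_sq_le_sq _ (by positivity)
    rw [EuclideanSpace.norm_sq_eq, Fin.sum_univ_three]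
    have q : ∀ b, ‖(x - x (faceOf x) • gridP n (idxOf n x)) b‖ ^ 2 ≤ D ^ 2 := by
      intro b
      have : ‖(x - x (faceOf x) • gridP n (idxOf n x)) b‖ ≤ D := by simpa using h b
      gcongr
    nlinarith [q 0, q 1, q 2, sq_nonneg D]
  refine hle.trans ?_
  rw [hD]
  have := sOf_le_norm x
  calc 2 * (|x (faceOf x)| * (2 / n)) = |x (faceOf x)| * (4 / n) := by ring
    _ ≤ _ := by gcongr

end

section
open MeasureTheory

noncomputable def sRho (x : E3) : ℝ := |x (faceOf x)| * rhoG x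

lemma sRho_nonneg (x : E3) : 0 ≤ sRho x := mul_nonneg (abs_nonneg _) (rhoG_pos x).le

lemma measurable_rhoG : Measurable rhoG := by
  apply Continuous.measurable
  unfold rhoG
  fun_prop

lemma measurable_sRho : Measurable sRho := measurable_sOf.mul measurable_rhoG

lemma integrable_sRho : Integrable sRho := by
  refine integrable_norm_rho.mono' measurable_sRho.aestronglyMeasurable ?_
  filter_upwards with x
  rw [Real.norm_of_nonneg (sRho_nonneg x)]
  exact mul_le_mul_of_nonneg_right (sOf_le_norm x) (rhoG_pos x).le

noncomputable def massK (n : ℕ) [NeZero n] (k : Fin 3 × (Fin n × Fin n)) : ℝ :=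
  ∫ x in idxOf n ⁻¹' {k}, sRho x

lemma massK_nonneg (n : ℕ) [NeZero n] (k) : 0 ≤ massK n k :=
  integral_nonneg sRho_nonneg

lemma sum_decomp (n : ℕ) [NeZero n] (G : Fin 3 × (Fin n × Fin n) → ℝ) (x : E3) :
    sRho x * G (idxOf n x) = ∑ k, (idxOf n ⁻¹' {k}).indicator sRho x * G k := by
  rw [Finset.sum_eq_single (idxOf n x)]
  · simp
  · intro k _ hk
    rw [Set.indicator_of_notMem, zero_mul]
    simpa using hk.symm
  · simp

lemma integrable_mass (n : ℕ) [NeZero n] (G : Fin 3 × (Fin n × Fin n) → ℝ) :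
    Integrable (fun x => sRho x * G (idxOf n x)) := by
  simp only [sum_decomp]
  apply integrable_finset_sum
  intro k _
  exact (integrable_sRho.indicator (measurable_idxOf n (measurableSet_singleton k))).mul_const _

lemma sum_mass (n : ℕ) [NeZero n] (G : Fin 3 × (Fin n × Fin n) → ℝ) :
    ∑ k, massK n k * G k = ∫ x, sRho x * G (idxOf n x) := by
  simp only [sum_decomp]
  rw [integral_finset_sum]
  · apply Finset.sum_congr rfl
    intro k _
    rw [integral_mul_const, integral_indicator (measurable_idxOf n (measurableSet_singleton k))]
    rfl
  · intro k _
    exact (integrable_sRho.indicator (measurable_idxOf n (measurableSet_singleton k))).mul_const _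

lemma mass_inner_ge (n : ℕ) [NeZero n] (c : E3) (hc : ‖c‖ = 1) :
    Real.pi - 8 * Real.pi / n ≤ ∑ k, massK n k * |⟪gridP n k, c⟫| := by
  rw [sum_mass n (fun k => |⟪gridP n k, c⟫|)]
  have h1 : ∫ x : E3, (|⟪x, c⟫| * rhoG x - ‖x‖ * rhoG x * (4 / n)) = Real.pi - 8 * Real.pi / n := by
    rw [integral_sub (integrable_inner_rho c) (integrable_norm_rho.mul_const _), integral_mul_const,
      integral_inner_rho c hc, integral_norm_rho]
    ring
  rw [← h1]
  refine integral_mono ((integrable_inner_rho c).sub (integrable_norm_rho.mul_const _)) (integrable_mass n (fun k => |⟪gridP n k, c⟫|)) ?_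
  intro x
  have h2 := vec_close n x
  have h3 : ⟪x, c⟫ = ⟪x - x (faceOf x) • gridP n (idxOf n x), c⟫ + x (faceOf x) * ⟪gridP n (idxOf n x), c⟫ := by
    rw [inner_sub_left, inner_smul_left]; simp
  have h4 := abs_real_inner_le_norm (x - x (faceOf x) • gridP n (idxOf n x)) c
  rw [hc, mul_one] at h4
  have h5 : |⟪x, c⟫| ≤ ‖x‖ * (4 / n) + |x (faceOf x)| * |⟪gridP n (idxOf n x), c⟫| := by
    rw [h3, ← abs_mul]
    exact (abs_add_le _ _).trans (add_le_add (h4.trans h2) le_rfl)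
  have h6 := (rhoG_pos x).le
  simp only [sRho]
  nlinarith

lemma mass_norm (n : ℕ) [NeZero n] :
    |∑ k, massK n k * ‖gridP n k‖ - 2 * Real.pi| ≤ 8 * Real.pi / n := by
  rw [sum_mass n (fun k => ‖gridP n k‖), ← integral_norm_rho, ← integral_sub (integrable_mass n (fun k => ‖gridP n k‖)) integrable_norm_rho]
  have h1 : ∫ x : E3, ‖x‖ * rhoG x * (4 / n) = 8 * Real.pi / n := by
    rw [integral_mul_const, integral_norm_rho]
    ring
  rw [← h1, ← Real.norm_eq_abs]
  refine norm_integral_le_of_norm_le (integrable_norm_rho.mul_const _) ?_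
  filter_upwards with x
  have h2 := vec_close n x
  have h3 : |‖x (faceOf x) • gridP n (idxOf n x)‖ - ‖x‖| ≤ ‖x‖ * (4 / n) := by
    refine (abs_norm_sub_norm_le _ _).trans ?_
    rw [norm_sub_rev]; exact h2
  rw [norm_smul, Real.norm_eq_abs] at h3
  have e : sRho x * ‖gridP n (idxOf n x)‖ - ‖x‖ * rhoG x
      = (|x (faceOf x)| * ‖gridP n (idxOf n x)‖ - ‖x‖) * rhoG x := by
    simp only [sRho]; ring
  rw [e, Real.norm_eq_abs, abs_mul, abs_of_pos (rhoG_pos x)]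
  have h6 := (rhoG_pos x).le
  nlinarith

lemma integral_abs_cube : ∫ t : ℝ, |t| ^ 3 * Real.exp (-t^2) = 1 := by
  have := integral_comp_abs (f := fun t : ℝ => t ^ 3 * Real.exp (-t^2))
  simp only [sq_abs] at this
  rw [this, integral_cube]; norm_num

lemma integrable_abs_cube : Integrable (fun t : ℝ => |t| ^ 3 * Real.exp (-t^2)) := by
  by_contra h
  have := integral_undef h
  rw [integral_abs_cube] at this
  norm_num at this

lemma massK_le (n : ℕ) [NeZero n] (k : Fin 3 × (Fin n × Fin n)) : massK n k ≤ 16 / (n:ℝ) ^ 2 := by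
  have hn : (0:ℝ) < n := by exact_mod_cast NeZero.pos n
  set f := k.1 with hf
  set a : Fin 2 → ℝ := fun j => gridP n k (f.succAbove j) with ha
  let S : Set (ℝ × (Fin 2 → ℝ)) := {p | p.2 ∈ Set.Icc (fun j => p.1 * a j - |p.1| * (2 / n)) (fun j => p.1 * a j + |p.1| * (2 / n))}
  have hS : MeasurableSet S := by
    apply IsClosed.measurableSet
    have : S = {p | (fun j => p.1 * a j - |p.1| * (2 / n)) ≤ p.2} ∩ {p | p.2 ≤ (fun j => p.1 * a j + |p.1| * (2 / n))} := rfl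
    rw [this]
    apply IsClosed.inter
    · exact isClosed_le (by fun_prop) (by fun_prop)
    · exact isClosed_le (by fun_prop) (by fun_prop)
  let H : ℝ × (Fin 2 → ℝ) → ENNReal := S.indicator (fun p => ENNReal.ofReal (|p.1| * Real.exp (-p.1 ^ 2)))
  have hHm : Measurable H := by
    apply Measurable.indicator _ hS
    fun_prop
  have hH : ∫⁻ p, H p ∂(volume.prod volume) = ENNReal.ofReal (16 / (n:ℝ) ^ 2) := by
    rw [lintegral_prod _ hHm.aemeasurable]
    have e : ∀ t : ℝ, ∫⁻ y, H (t, y) = ENNReal.ofReal (16 / (n:ℝ) ^ 2 * (|t| ^ 3 * Real.exp (-t^2))) := by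
      intro t
      have e1 : ∀ y, H (t, y) = (Set.Icc (fun j => t * a j - |t| * (2 / n)) (fun j => t * a j + |t| * (2 / n))).indicator
          (fun _ => ENNReal.ofReal (|t| * Real.exp (-t ^ 2))) y := by
        intro y
        rfl
      simp only [e1]
      rw [lintegral_indicator_const measurableSet_Icc, Real.volume_Icc_pi, Fin.prod_univ_two]
      rw [← ENNReal.ofReal_mul, ← ENNReal.ofReal_mul]
      · congr 1; field_simp; ring
      · positivity
      · have : 0 ≤ |t| * (2 / n) := by positivity
        linarith
    simp only [e]
    rw [← ofReal_integral_eq_lintegral_ofReal (integrable_abs_cube.const_mul _), integral_const_mul, integral_abs_cube, mul_one]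
    filter_upwards with t
    simp only [Pi.zero_apply]
    positivity
  unfold massK
  rw [integral_eq_lintegral_of_nonneg_ae (by filter_upwards with x using sRho_nonneg x) measurable_sRho.aestronglyMeasurable]
  apply ENNReal.toReal_le_of_le_ofReal (by positivity)
  rw [← hH, ← lintegral_indicator (measurable_idxOf n (measurableSet_singleton k))]
  rw [← (PiLp.volume_preserving_toLp (Fin 3)).lintegral_comp_emb (MeasurableEquiv.toLp 2 _).measurableEmbedding]
  have hmp := volume_preserving_piFinSuccAbove (fun _ : Fin 3 => ℝ) f
  change _ ≤ ∫⁻ p, H p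
  rw [← hmp.lintegral_comp_emb (MeasurableEquiv.measurableEmbedding _)]
  apply lintegral_mono
  intro x
  simp only []
  by_cases hx : idxOf n (WithLp.toLp 2 x : E3) = k
  · rw [Set.indicator_of_mem (by exact hx)]
    have hfx : faceOf (WithLp.toLp 2 x : E3) = f := by rw [hf, ← hx]; rfl
    have hc := coord_close n (WithLp.toLp 2 x : E3)
    rw [hfx, hx] at hc
    simp only [H]
    rw [Set.indicator_of_mem]
    · apply ENNReal.ofReal_le_ofReal
      simp only [sRho, hfx]
      have : rhoG (WithLp.toLp 2 x : E3) ≤ Real.exp (-x f ^ 2) := by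
        unfold rhoG
        apply Real.exp_le_exp.2
        have h := sOf_le_norm (WithLp.toLp 2 x : E3)
        rw [hfx] at h
        have := pow_le_pow_left₀ (abs_nonneg _) h 2
        simp only [sq_abs] at this
        linarith
      exact mul_le_mul_of_nonneg_left this (abs_nonneg _)
    · constructor
      · intro j
        have := (abs_le.1 (hc (f.succAbove j))).1
        change x f * a j - |x f| * (2 / n) ≤ x (f.succAbove j)
        simp only at this
        simp only [ha]
        linarith
      · intro j
        have := (abs_le.1 (hc (f.succAbove j))).2
        change x (f.succAbove j) ≤ x f * a j + |x f| * (2 / n)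
        simp only at this
        simp only [ha]
        linarith
  · rw [Set.indicator_of_notMem (by exact hx)]
    exact zero_le

end


lemma cell_card (n L l' : ℕ) (hn : n = 2 ^ L) (hl : l' ≤ L) (k : ℕ × ℕ) :
    (Finset.univ.filter (fun p : Fin n × Fin n =>
      cellL l' (((p.1 : ℕ) : ℝ) / n) (((p.2 : ℕ) : ℝ) / n) = k)).card ≤ 4 ^ (L - l') := by
  set d := L - l' with hd
  have hc : ∀ p : Fin n × Fin n, cellL l' (((p.1 : ℕ) : ℝ) / n) (((p.2 : ℕ) : ℝ) / n)
      = ((p.1 : ℕ) / 2 ^ d, (p.2 : ℕ) / 2 ^ d) := by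
    intro p
    rw [cellL_coarse L l' hl]
    have e : ∀ a : ℕ, ⌊(2:ℝ) ^ L * ((a:ℝ) / n)⌋₊ = a := by
      intro a
      have : (2:ℝ) ^ L * ((a:ℝ) / n) = a := by
        rw [hn]; push_cast; field_simp
      rw [this, Nat.floor_natCast]
    simp only [cellL, e]
    rw [hd]
  have hcard : (Finset.range (2 ^ d) ×ˢ Finset.range (2 ^ d)).card = 4 ^ d := by
    rw [Finset.card_product, Finset.card_range, ← mul_pow]
    norm_num
  rw [← hcard]
  apply Finset.card_le_card_of_injOn (fun p => ((p.1 : ℕ) % 2 ^ d, (p.2 : ℕ) % 2 ^ d))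
  · intro p _
    simp [Nat.mod_lt]
  · intro p hp q hq hpq
    simp only [Finset.coe_filter, Finset.mem_univ, true_and, Set.mem_setOf_eq] at hp hq
    rw [hc] at hp hq
    have h := hp.trans hq.symm
    simp only [Prod.mk.injEq] at h hpq
    have a1 := Nat.div_add_mod (p.1 : ℕ) (2 ^ d)
    have a2 := Nat.div_add_mod (q.1 : ℕ) (2 ^ d)
    have b1 := Nat.div_add_mod (p.2 : ℕ) (2 ^ d)
    have b2 := Nat.div_add_mod (q.2 : ℕ) (2 ^ d)
    rw [h.1, hpq.1, a2] at a1
    rw [h.2, hpq.2, b2] at b1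
    exact Prod.ext (Fin.ext a1.symm) (Fin.ext b1.symm)

lemma gridP_inner (n : ℕ) (f : Fin 3) (p : Fin n × Fin n) (c : E3) :
    ⟪gridP n (f, p), c⟫ = linF ![2 * c (f.succAbove 0), 2 * c (f.succAbove 1),
      c f - c (f.succAbove 0) - c (f.succAbove 1)] (((p.1 : ℕ) : ℝ) / n) (((p.2 : ℕ) : ℝ) / n) := by
  rw [PiLp.inner_apply, Fin.sum_univ_succAbove _ f, Fin.sum_univ_two]
  have h0 := gridP_same n (f, p)
  have h1 := gridP_zero n (f, p)
  have h2 := gridP_one n (f, p)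
  simp only at h0 h1 h2
  rw [h0, h1, h2]
  simp [linF]
  ring

lemma gridP_norm_ge (n : ℕ) (k : Fin 3 × (Fin n × Fin n)) : 1 ≤ ‖gridP n k‖ := by
  have := PiLp.norm_apply_le (gridP n k) k.1
  rw [gridP_same] at this
  simpa using this

lemma face_reduce (l0 n : ℕ) [NeZero n] (hn : n = 2 ^ (3 * l0)) (f : Fin 3) :
    ∃ w' : Fin n × Fin n → ℝ, (∀ i, 0 ≤ w' i) ∧ (Finset.univ.filter (fun i => w' i ≠ 0)).card ≤ 104 * 4 ^ l0 ∧
      (∑ i, w' i * ‖gridP n (f, i)‖ = ∑ i, massK n (f, i) * ‖gridP n (f, i)‖) ∧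
      ∀ c : E3, ‖c‖ = 1 →
        |∑ i, (w' i - massK n (f, i)) * abs ⟪gridP n (f, i), c⟫| ≤ 81744 * 16 * etaC ^ l0 * 3 := by
  have hn0 : (0:ℝ) < n := by exact_mod_cast NeZero.pos n
  have hlt : ∀ a : Fin n, 0 ≤ ((a : ℕ) : ℝ) / n ∧ ((a : ℕ) : ℝ) / n < 1 := by
    intro a
    refine ⟨by positivity, ?_⟩
    rw [div_lt_one hn0]
    exact_mod_cast a.2
  obtain ⟨w', h1, h2, h3, h4⟩ := planar_reduction (fun p : Fin n × Fin n => ((p.1 : ℕ) : ℝ) / n)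
    (fun p => ((p.2 : ℕ) : ℝ) / n) (fun p => ‖gridP n (f, p)‖) l0 (3 * l0) (by omega) 16 (by norm_num)
    (fun p => hlt p.1) (fun p => hlt p.2) (fun p => massK n (f, p)) (fun p => massK_nonneg n _)
    (by
      intro l' hl k
      refine (Finset.sum_le_card_nsmul _ _ (16 / (n:ℝ)^2) (fun p _ => massK_le n _)).trans ?_
      have hc := cell_card n (3 * l0) l' hn hl k
      rw [nsmul_eq_mul]
      have hc' : ((Finset.univ.filter (fun p : Fin n × Fin n =>
        cellL l' (((p.1 : ℕ) : ℝ) / n) (((p.2 : ℕ) : ℝ) / n) = k)).card : ℝ) ≤ 4 ^ (3 * l0 - l') := by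
        exact_mod_cast hc
      have hn2 : (n:ℝ) ^ 2 = 4 ^ (3 * l0 - l') * 4 ^ l' := by
        rw [← pow_add, Nat.sub_add_cancel hl, hn]
        push_cast
        rw [← pow_mul, mul_comm, pow_mul]
        norm_num
      calc _ ≤ (4:ℝ) ^ (3 * l0 - l') * (16 / (n:ℝ) ^ 2) := by gcongr
        _ = 16 / 4 ^ l' := by rw [hn2]; field_simp)
    (by
      rw [Fintype.card_prod, Fintype.card_fin, hn, ← mul_pow]
      norm_num)
  refine ⟨w', h1, h2, h3, fun c hc => ?_⟩
  have hb : ∀ b, |c b| ≤ 1 := by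
    intro b
    have := PiLp.norm_apply_le c b
    rw [hc] at this
    exact this
  have := h4 ![2 * c (f.succAbove 0), 2 * c (f.succAbove 1),
      c f - c (f.succAbove 0) - c (f.succAbove 1)] 3 (by
    have q1 := abs_le.1 (hb f)
    have q2 := abs_le.1 (hb (f.succAbove 0))
    have q3 := abs_le.1 (hb (f.succAbove 1))
    intro a
    fin_cases a
    · show |2 * c (f.succAbove 0)| ≤ 3
      rw [abs_le]; constructor <;> linarith
    · show |2 * c (f.succAbove 1)| ≤ 3
      rw [abs_le]; constructor <;> linarith
    · show |c f - c (f.succAbove 0) - c (f.succAbove 1)| ≤ 3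
      rw [abs_le]; constructor <;> linarith)
  simp only [gridP_inner]
  exact this

lemma family_exists (l0 : ℕ) (hl : 1 ≤ l0) :
    ∃ N : ℕ, N ≤ 312 * 4 ^ l0 ∧
        ∃ (v : Fin N → E3) (α : Fin N → ℝ),
          (∀ i, ‖v i‖ = 1) ∧ (∀ i, 0 ≤ α i) ∧ (∑ i, α i = 1) ∧
          ∀ c : E3, ‖c‖ = 1 → 1 / 2 - 11771142 * etaC ^ l0 ≤ ∑ i, α i * |⟪v i, c⟫| := by
  obtain ⟨n, hn⟩ : ∃ n, n = 2 ^ (3 * l0) := ⟨_, rfl⟩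
  haveI : NeZero n := ⟨by rw [hn]; positivity⟩
  have hn0 : (0:ℝ) < n := by exact_mod_cast NeZero.pos n
  choose w hw0 hwc hwn hwi using face_reduce l0 n hn
  set h := etaC ^ l0 with hh
  have hh0 : 0 < h := pow_pos etaC_pos _
  have hnh : 1 / (n:ℝ) ≤ h := by
    have := eta8 l0
    rw [hn]; push_cast; exact this
  have hn8 : (8:ℝ) ≤ n := by
    have : 2 ^ 3 ≤ 2 ^ (3 * l0) := Nat.pow_le_pow_right (by norm_num) (by omega)
    rw [hn]; exact_mod_cast this
  have hpi := Real.pi_pos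
  have hpi3 := Real.pi_gt_three
  let W : Fin 3 × (Fin n × Fin n) → ℝ := fun k => w k.1 k.2
  have hW0 : ∀ k, 0 ≤ W k := fun k => hw0 _ _
  set Z := ∑ k, W k * ‖gridP n k‖ with hZ
  have hZ' : Z = ∑ k, massK n k * ‖gridP n k‖ := by
    rw [hZ, Fintype.sum_prod_type, Fintype.sum_prod_type]
    exact Finset.sum_congr rfl (fun f _ => hwn f)
  have hZb := abs_le.1 (mass_norm n)
  rw [← hZ'] at hZb
  have hpn : 8 * Real.pi / n = 8 * Real.pi * (1 / n) := by ring
  have hZpos : 0 < Z := by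
    have : 8 * Real.pi / n ≤ Real.pi := by
      rw [div_le_iff₀ hn0]; nlinarith
    linarith [hZb.1]
  have hZle : Z ≤ 2 * Real.pi + 8 * Real.pi * h := by
    have : 8 * Real.pi / n ≤ 8 * Real.pi * h := by rw [hpn]; gcongr
    linarith [hZb.2]
  have hnum : ∀ c : E3, ‖c‖ = 1 → Real.pi - 8 * Real.pi * h - 11771136 * h ≤ ∑ k, W k * |⟪gridP n k, c⟫| := by
    intro c hc
    have h1 := mass_inner_ge n c hc
    have h2 : ∑ k, W k * |⟪gridP n k, c⟫| = ∑ k, massK n k * |⟪gridP n k, c⟫|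
        + ∑ f, ∑ i, (w f i - massK n (f, i)) * abs ⟪gridP n (f, i), c⟫ := by
      rw [Fintype.sum_prod_type, Fintype.sum_prod_type, ← Finset.sum_add_distrib]
      apply Finset.sum_congr rfl; intro f _
      rw [← Finset.sum_add_distrib]
      apply Finset.sum_congr rfl; intro i _
      simp only [W]; ring
    rw [h2, Fin.sum_univ_three]
    have a0 := (abs_le.1 (hwi 0 c hc)).1
    have a1 := (abs_le.1 (hwi 1 c hc)).1
    have a2 := (abs_le.1 (hwi 2 c hc)).1
    have : 8 * Real.pi / n ≤ 8 * Real.pi * h := by rw [hpn]; gcongr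
    linarith
  let S := Finset.univ.filter (fun k => W k ≠ 0)
  have hScard : S.card ≤ 312 * 4 ^ l0 := by
    have : S.card = ∑ f, (Finset.univ.filter (fun i => w f i ≠ 0)).card := by
      simp only [S, Finset.card_filter, W]
      rw [Fintype.sum_prod_type]
    rw [this]
    refine (Finset.sum_le_card_nsmul _ _ _ (fun f _ => hwc f)).trans ?_
    simp
    omega
  have hre : ∀ G : Fin 3 × (Fin n × Fin n) → ℝ,
      ∑ i : Fin S.card, W (S.equivFin.symm i) * G (S.equivFin.symm i) = ∑ k, W k * G k := by
    intro G
    rw [Equiv.sum_comp S.equivFin.symm (fun k : S => W k * G k), Finset.sum_coe_sort S (fun k => W k * G k)]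
    apply Finset.sum_subset (Finset.subset_univ _)
    intro k _ hk
    have : W k = 0 := by simpa [S] using hk
    rw [this, zero_mul]
  have hP : ∀ k, 0 < ‖gridP n k‖ := fun k => lt_of_lt_of_le one_pos (gridP_norm_ge n k)
  refine ⟨S.card, hScard, fun i => ‖gridP n (S.equivFin.symm i)‖⁻¹ • gridP n (S.equivFin.symm i),
    fun i => W (S.equivFin.symm i) * (‖gridP n (S.equivFin.symm i)‖ / Z), ?_, ?_, ?_, ?_⟩
  · intro i
    rw [norm_smul, norm_inv, norm_norm, inv_mul_cancel₀ (hP _).ne']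
  · intro i
    exact mul_nonneg (hW0 _) (div_nonneg (norm_nonneg _) hZpos.le)
  · rw [hre (fun k => ‖gridP n k‖ / Z)]
    have : ∀ k, W k * (‖gridP n k‖ / Z) = (W k * ‖gridP n k‖) / Z := fun k => by ring
    simp only [this]
    rw [← Finset.sum_div, ← hZ, div_self hZpos.ne']
  · intro c hc
    have e : ∀ k, W k * (‖gridP n k‖ / Z) * |⟪‖gridP n k‖⁻¹ • gridP n k, c⟫| = W k * (|⟪gridP n k, c⟫| / Z) := by
      intro k
      rw [real_inner_smul_left, abs_mul, abs_of_pos (inv_pos.2 (hP k))]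
      have := (hP k).ne'
      field_simp
    simp only [e]
    rw [hre (fun k => |⟪gridP n k, c⟫| / Z)]
    have : ∀ k, W k * (|⟪gridP n k, c⟫| / Z) = (W k * |⟪gridP n k, c⟫|) / Z := fun k => by ring
    simp only [this]
    rw [← Finset.sum_div, le_div_iff₀ hZpos]
    by_cases hneg : 1 / 2 - 11771142 * h ≤ 0
    · have : 0 ≤ ∑ k, W k * |⟪gridP n k, c⟫| := Finset.sum_nonneg (fun k _ => mul_nonneg (hW0 k) (abs_nonneg _))
      nlinarith
    · push Not at hneg
      refine le_trans ?_ (hnum c hc)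
      refine (mul_le_mul_of_nonneg_left hZle hneg.le).trans ?_
      nlinarith [mul_pos hpi hh0, mul_pos (mul_pos hpi hh0) hh0]

/-- Upper bound `N(r) ≤ C·(1/2 − r)^(−4/5)` on the compatibility complexity: there is a
constant `C > 0` such that for every `r ∈ [0, 1/2)` there are `n ≤ C·(1/2 − r)^(−4/5)`
unit vectors `nᵢ ∈ ℝ³` and weights `αᵢ ≥ 0` summing to 1 with `Σᵢ αᵢ|⟨nᵢ, c⟩| ≥ r` for
every unit vector `c`, i.e. the zonotope generated by `{±αᵢnᵢ}` contains the closed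
ball of radius `r`. -/
theorem complexity_upper_bound :
    ∃ C : ℝ, 0 < C ∧ ∀ r : ℝ, 0 ≤ r → r < 1 / 2 →
      ∃ n : ℕ, (n : ℝ) ≤ C * (1 / 2 - r) ^ (-(4 / 5 : ℝ)) ∧
        ∃ (v : Fin n → EuclideanSpace ℝ (Fin 3)) (α : Fin n → ℝ),
          (∀ i, ‖v i‖ = 1) ∧ (∀ i, 0 ≤ α i) ∧ (∑ i, α i = 1) ∧
          ∀ c : EuclideanSpace ℝ (Fin 3), ‖c‖ = 1 →
            r ≤ ∑ i, α i * |⟪v i, c⟫| := by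
  obtain ⟨K, hK⟩ : ∃ K : ℝ, K = 11771142 := ⟨_, rfl⟩
  have hK1 : 1 ≤ K := by rw [hK]; norm_num
  have hK0 : 0 < K := by linarith
  refine ⟨1248 * K ^ (4 / 5 : ℝ), by positivity, fun r hr0 hr => ?_⟩
  set ε := 1 / 2 - r with hε
  have hε0 : 0 < ε := by linarith
  have hε1 : ε ≤ 1 := by linarith
  set X := (K / ε) ^ (4 / 5 : ℝ) with hX
  have hq : 1 ≤ K / ε := by rw [le_div_iff₀ hε0]; linarith
  have hX1 : 1 ≤ X := Real.one_le_rpow hq (by norm_num)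
  have hX5 : X ^ 5 = (K / ε) ^ 4 := by
    rw [hX, ← Real.rpow_natCast, ← Real.rpow_mul (by positivity), ← Real.rpow_natCast]
    norm_num
  obtain ⟨l, hl1, hl2⟩ := exists_nat_pow_near hX1 (by norm_num : (1:ℝ) < 4)
  obtain ⟨N, hN, v, α, h1, h2, h3, h4⟩ := family_exists (l + 1) (by omega)
  refine ⟨N, ?_, v, α, h1, h2, h3, fun c hc => le_trans ?_ (h4 c hc)⟩
  · have hN' : (N:ℝ) ≤ 312 * 4 ^ (l + 1) := by exact_mod_cast hN
    have hXe : K ^ (4 / 5 : ℝ) * ε ^ (-(4 / 5 : ℝ)) = X := by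
      rw [hX, Real.div_rpow hK0.le hε0.le, Real.rpow_neg hε0.le]; rfl
    rw [mul_assoc, hXe]
    rw [pow_succ] at hN'
    linarith
  · rw [← hK]
    have he : etaC ^ (l + 1) ≤ ε / K := by
      apply le_of_pow_le_pow_left₀ (n := 4) (by norm_num) (by positivity)
      have e1 : (etaC ^ (l + 1)) ^ 4 = 1 / (4 ^ (l + 1)) ^ 5 := by
        have : etaC ^ 4 = 1 / 4 ^ 5 := by
          have := etaC_sq
          calc etaC ^ 4 = (etaC ^ 2) ^ 2 := by ring
            _ = _ := by rw [this]; norm_num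
        rw [← pow_mul, mul_comm, pow_mul, this, ← pow_mul, mul_comm (l + 1), pow_mul]
        rw [one_div, one_div, inv_pow]
      have e2 : (ε / K) ^ 4 = 1 / X ^ 5 := by
        rw [hX5, ← inv_div, inv_pow, one_div]
      rw [e1, e2]
      have : X ^ 5 ≤ ((4:ℝ) ^ (l + 1)) ^ 5 := pow_le_pow_left₀ (by linarith) hl2.le 5
      exact one_div_le_one_div_of_le (by positivity) this
    have : K * etaC ^ (l + 1) ≤ ε := by
      rw [le_div_iff₀ hK0] at he; linarith
    linarith
end

section
/- Let n₁,…,n_n be unit vectors in ℝ³, η₁,…,η_n ∈ [0,1], and α₁,…,α_n ≥ 0 with Σᵢ αᵢ = 1 and Σᵢ αᵢ ηᵢ nᵢ = 0. Define m = {2·Σᵢ xᵢ αᵢ ηᵢ nᵢ : 0 ≤ xᵢ ≤ 1, Σᵢ xᵢ αᵢ = 1/2} ⊆ ℝ³. Then the inradius of m (the supremum of r ≥ 0 such that the closed ball of radius r centered at the origin is contained in m) equals the infimum over unit vectors c ∈ ℝ³ and c₀ ∈ [−1,1] of Σᵢ αᵢ·|c₀ + ηᵢ·⟨c, nᵢ⟩|.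 -/
open scoped RealInnerProductSpace

/-- Clamping to `[-1, 1]` does not increase `|c₀ + b|` for `|b| ≤ 1`. -/
lemma clamp_abs_le (a b : ℝ) (hb : |b| ≤ 1) : |max (-1) (min 1 a) + b| ≤ |a + b| := by
  obtain ⟨h1, h2⟩ := abs_le.mp hb
  rcases le_total 1 a with h | h
  · rw [min_eq_left h, max_eq_right (by norm_num), abs_of_nonneg (by linarith),
      abs_of_nonneg (by linarith)]
    linarith
  · rw [min_eq_right h]
    rcases le_total (-1) a with h' | h'
    · rw [max_eq_right h']
    · rw [max_eq_left h', abs_of_nonpos (by linarith), abs_of_nonpos (by linarith)]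
      linarith

/-- The support-function separation step. -/
lemma mem_of_support {E : Type*} [NormedAddCommGroup E] [InnerProductSpace ℝ E] [CompleteSpace E]
    (n : ℕ) (w : Fin n → E) (α : Fin n → ℝ) (y : E)
    (h : ∀ (c : E) (c₀ : ℝ), ⟪c, y⟫ ≤ ∑ i, |c₀ * α i + ⟪c, w i⟫|) :
    ∃ s : Fin n → ℝ, (∀ i, -1 ≤ s i ∧ s i ≤ 1) ∧ ∑ i, s i * α i = 0 ∧ ∑ i, s i • w i = y := by
  let L : (Fin n → ℝ) →ₗ[ℝ] ℝ × E :=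
    ∑ i, (LinearMap.proj i : (Fin n → ℝ) →ₗ[ℝ] ℝ).smulRight ((α i, w i) : ℝ × E)
  have hL : ∀ s, L s = ∑ i, s i • ((α i, w i) : ℝ × E) := by
    intro s; simp [L]
  have hLc : Continuous L := L.continuous_of_finiteDimensional
  let K : Set (Fin n → ℝ) := Set.Icc (fun _ => -1) (fun _ => 1)
  by_cases hy : ((0, y) : ℝ × E) ∈ L '' K
  · obtain ⟨s, hs, hsy⟩ := hy
    rw [hL] at hsy
    refine ⟨s, fun i => ⟨hs.1 i, hs.2 i⟩, ?_, ?_⟩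
    · have := congrArg Prod.fst hsy
      simpa [Prod.fst_sum] using this
    · have := congrArg Prod.snd hsy
      simpa [Prod.snd_sum] using this
  · exfalso
    have hconv : Convex ℝ (L '' K) := (convex_Icc _ _).linear_image L
    have hclosed : IsClosed (L '' K) := (isCompact_Icc.image hLc).isClosed
    obtain ⟨f, u, hf, hu⟩ := geometric_hahn_banach_closed_point hconv hclosed hy
    let c : E := (InnerProductSpace.toDual ℝ E).symm (f.comp (ContinuousLinearMap.inr ℝ ℝ E))
    have hc : ∀ z : E, ⟪c, z⟫ = f (0, z) := by
      intro z; simp [c]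
    have hfd : ∀ (t : ℝ) (z : E), f (t, z) = f (1, 0) * t + ⟪c, z⟫ := by
      intro t z
      have : ((t, z) : ℝ × E) = t • ((1, 0) : ℝ × E) + (0, z) := by simp
      rw [this, map_add, map_smul, hc, smul_eq_mul, mul_comm]
    let s : Fin n → ℝ := fun i => SignType.sign (f (1, 0) * α i + ⟪c, w i⟫)
    have hsK : s ∈ K := by
      constructor <;> intro i <;> simp only [s] <;>
        rcases SignType.sign (f (1, 0) * α i + ⟪c, w i⟫) with _ | _ | _ <;> norm_num
    have h1 := hf _ ⟨s, hsK, rfl⟩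
    have h2 : f (L s) = ∑ i, |f (1, 0) * α i + ⟪c, w i⟫| := by
      rw [hL, map_sum]
      refine Finset.sum_congr rfl fun i _ => ?_
      rw [map_smul, hfd, smul_eq_mul]
      exact sign_mul_self _
    have h3 := h c (f (1, 0))
    rw [hc] at h3
    linarith

/-- The compatibility radius as a geometric inradius equals the optimization formula:
for a qubit POVM with effects `Πᵢ = αᵢ(I + ηᵢ nᵢ·σ)` (constraints `Σᵢ αᵢ = 1`,
`Σᵢ αᵢηᵢnᵢ = 0`), the supremum of radii `r ≥ 0` such that the closed ball of radius `r`
about the origin is contained in the unbiased compatible region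
`m = {2·Σᵢ xᵢ αᵢ ηᵢ nᵢ : 0 ≤ xᵢ ≤ 1, Σᵢ xᵢ αᵢ = 1/2}` equals
`inf_{‖c‖=1, c₀∈[−1,1]} Σᵢ αᵢ|c₀ + ηᵢ⟨c, nᵢ⟩|`. -/
theorem compatibility_radius_formula
    (n : ℕ) (v : Fin n → EuclideanSpace ℝ (Fin 3)) (hv : ∀ i, ‖v i‖ = 1)
    (η : Fin n → ℝ) (hη : ∀ i, η i ∈ Set.Icc (0 : ℝ) 1)
    (α : Fin n → ℝ) (hα : ∀ i, 0 ≤ α i) (hαsum : ∑ i, α i = 1)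
    (hcomplete : ∑ i, (α i * η i) • v i = 0) :
    sSup {r : ℝ | 0 ≤ r ∧
        Metric.closedBall (0 : EuclideanSpace ℝ (Fin 3)) r ⊆
          {y | ∃ x : Fin n → ℝ, (∀ i, 0 ≤ x i ∧ x i ≤ 1) ∧
            (∑ i, x i * α i = 1 / 2) ∧ y = ∑ i, (2 * (x i * (α i * η i))) • v i}} =
      sInf {t : ℝ | ∃ (c : EuclideanSpace ℝ (Fin 3)) (c₀ : ℝ), ‖c‖ = 1 ∧
        c₀ ∈ Set.Icc (-1 : ℝ) 1 ∧ t = ∑ i, α i * |c₀ + η i * ⟪c, v i⟫|} := by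
  have hb : ∀ (c : EuclideanSpace ℝ (Fin 3)), ‖c‖ = 1 → ∀ i, |η i * ⟪c, v i⟫| ≤ 1 := by
    intro c hc i
    rw [abs_mul, abs_of_nonneg (hη i).1]
    have := abs_real_inner_le_norm c (v i)
    rw [hc, hv i, one_mul] at this
    exact mul_le_one₀ (hη i).2 (abs_nonneg _) this
  set T := {t : ℝ | ∃ (c : EuclideanSpace ℝ (Fin 3)) (c₀ : ℝ), ‖c‖ = 1 ∧
        c₀ ∈ Set.Icc (-1 : ℝ) 1 ∧ t = ∑ i, α i * |c₀ + η i * ⟪c, v i⟫|} with hT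
  have hT0 : ∀ t ∈ T, 0 ≤ t := by
    rintro t ⟨c, c₀, -, -, rfl⟩
    exact Finset.sum_nonneg fun i _ => mul_nonneg (hα i) (abs_nonneg _)
  have hTb : BddBelow T := ⟨0, fun t ht => hT0 t ht⟩
  obtain ⟨e, he⟩ : ∃ e : EuclideanSpace ℝ (Fin 3), ‖e‖ = 1 :=
    ⟨EuclideanSpace.single 0 1, by simp⟩
  have hTne : T.Nonempty := ⟨_, e, 0, he, by norm_num, rfl⟩
  have hR0 : 0 ≤ sInf T := le_csInf hTne hT0
  refine IsGreatest.csSup_eq ⟨⟨hR0, ?_⟩, ?_⟩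
  · intro y hy
    rw [mem_closedBall_zero_iff] at hy
    obtain ⟨s, hs, hs0, hsy⟩ := mem_of_support n (fun i => (α i * η i) • v i) α y (by
      intro c c₀
      rcases eq_or_ne c 0 with rfl | hc
      · simp only [inner_zero_left]
        exact Finset.sum_nonneg fun i _ => abs_nonneg _
      have hcp : 0 < ‖c‖ := norm_pos_iff.mpr hc
      have hc1 : ‖(‖c‖⁻¹ • c)‖ = 1 := by
        rw [norm_smul, norm_inv, norm_norm, inv_mul_cancel₀ hcp.ne']
      have hle : sInf T ≤ _ := csInf_le hTb ⟨‖c‖⁻¹ • c, max (-1) (min 1 (‖c‖⁻¹ * c₀)), hc1,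
        ⟨le_max_left _ _, max_le (by norm_num) (min_le_left _ _)⟩, rfl⟩
      have h2 : ∑ i, α i * |max (-1) (min 1 (‖c‖⁻¹ * c₀)) + η i * ⟪‖c‖⁻¹ • c, v i⟫| ≤
          ∑ i, α i * |‖c‖⁻¹ * c₀ + η i * ⟪‖c‖⁻¹ • c, v i⟫| :=
        Finset.sum_le_sum fun i _ =>
          mul_le_mul_of_nonneg_left (clamp_abs_le _ _ (hb _ hc1 i)) (hα i)
      have h3 : ‖c‖ * ∑ i, α i * |‖c‖⁻¹ * c₀ + η i * ⟪‖c‖⁻¹ • c, v i⟫| =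
          ∑ i, |c₀ * α i + ⟪c, (α i * η i) • v i⟫| := by
        rw [Finset.mul_sum]
        refine Finset.sum_congr rfl fun i _ => ?_
        rw [real_inner_smul_left, real_inner_smul_right]
        have : c₀ * α i + α i * η i * ⟪c, v i⟫ =
            ‖c‖ * (α i * (‖c‖⁻¹ * c₀ + η i * (‖c‖⁻¹ * ⟪c, v i⟫))) := by
          field_simp
        rw [this, abs_mul, abs_mul, abs_of_nonneg (hα i), abs_of_pos hcp]
      calc ⟪c, y⟫ ≤ ‖c‖ * ‖y‖ := real_inner_le_norm _ _
        _ ≤ _ := mul_le_mul_of_nonneg_left (hy.trans (hle.trans h2)) hcp.le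
        _ = _ := h3)
    refine ⟨fun i => (s i + 1) / 2, fun i => ?_, ?_, ?_⟩
    · obtain ⟨h1, h2⟩ := hs i
      constructor <;> linarith
    · have : ∀ i, (s i + 1) / 2 * α i = (1 / 2) * (s i * α i) + (1 / 2) * α i := by
        intro i; ring
      simp only [this, Finset.sum_add_distrib, ← Finset.mul_sum, hs0, hαsum]
      norm_num
    · have : ∀ i, (2 * ((s i + 1) / 2 * (α i * η i))) • v i =
          s i • ((α i * η i) • v i) + (α i * η i) • v i := by
        intro i; rw [smul_smul, ← add_smul]; congr 1; ring
      simp only [this, Finset.sum_add_distrib, hcomplete, add_zero]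
      exact hsy.symm
  · rintro r ⟨hr, hsub⟩
    refine le_csInf hTne ?_
    rintro t ⟨c, c₀, hc, -, rfl⟩
    obtain ⟨x, hx, hx1, hxy⟩ := hsub (show r • c ∈ Metric.closedBall 0 r by
      rw [mem_closedBall_zero_iff, norm_smul, hc, mul_one, Real.norm_of_nonneg hr])
    have h1 : r = ∑ i, 2 * (x i * (α i * η i)) * ⟪c, v i⟫ := by
      have := congrArg (fun z => ⟪c, z⟫) hxy
      simpa only [real_inner_smul_right, inner_sum, real_inner_self_eq_norm_sq, hc, one_pow,
        mul_one] using this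
    have h2 : ∑ i, (α i * η i) * ⟪c, v i⟫ = 0 := by
      have := congrArg (fun z => ⟪c, z⟫) hcomplete
      simpa only [real_inner_smul_right, inner_sum, inner_zero_right] using this
    have h3 : r = ∑ i, α i * ((2 * x i - 1) * (c₀ + η i * ⟪c, v i⟫)) := by
      have : ∀ i, α i * ((2 * x i - 1) * (c₀ + η i * ⟪c, v i⟫)) =
          2 * (x i * (α i * η i)) * ⟪c, v i⟫ - (α i * η i) * ⟪c, v i⟫
            + (2 * c₀) * (x i * α i) - c₀ * α i := by intro i; ring
      simp only [this, Finset.sum_add_distrib, Finset.sum_sub_distrib, ← Finset.mul_sum, hx1,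
        hαsum, h2, ← h1]
      ring
    rw [h3]
    refine Finset.sum_le_sum fun i _ => mul_le_mul_of_nonneg_left ?_ (hα i)
    obtain ⟨h4, h5⟩ := hx i
    calc _ ≤ |(2 * x i - 1) * (c₀ + η i * ⟪c, v i⟫)| := le_abs_self _
      _ = |2 * x i - 1| * |c₀ + η i * ⟪c, v i⟫| := abs_mul _ _
      _ ≤ 1 * |c₀ + η i * ⟪c, v i⟫| :=
        mul_le_mul_of_nonneg_right (abs_le.mpr ⟨by linarith, by linarith⟩) (abs_nonneg _)
      _ = _ := one_mul _
end

section
/- Let n₁,…,n_n be unit vectors in ℝ³, η₁,…,η_n ∈ [0,1], and α₁,…,α_n ≥ 0 with Σᵢ αᵢ = 1, Σᵢ αᵢ ηᵢ nᵢ = 0, and s := Σⱼ αⱼ ηⱼ > 0. Set βᵢ = αᵢηᵢ/s. Then inf over unit vectors c ∈ ℝ³ and c₀ ∈ [−1,1] of Σᵢ βᵢ·|c₀ + ⟨c, nᵢ⟩| is greater than or equal to inf over unit vectors c ∈ ℝ³ and c₀ ∈ [−1,1] of Σᵢ αᵢ·|c₀ + ηᵢ·⟨c, nᵢ⟩|.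 (The compatibility radius is maximized by rank-one POVMs, i.e., one may assume ηᵢ = 1.) -/
open scoped RealInnerProductSpace

/-- The compatibility radius is maximized by rank-one POVMs: for a qubit POVM with
effects `Πᵢ = αᵢ(I + ηᵢ nᵢ·σ)` (constraints `Σᵢ αᵢ = 1`, `Σᵢ αᵢηᵢnᵢ = 0`,
`s := Σⱼ αⱼηⱼ > 0`), the compatibility radius of the rank-one POVM with weights
`βᵢ = αᵢηᵢ/s` and the same unit directions is at least that of the original POVM. -/
theorem rank_one_povm_maximizes_radius
    (n : ℕ) (v : Fin n → EuclideanSpace ℝ (Fin 3)) (hv : ∀ i, ‖v i‖ = 1)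
    (η : Fin n → ℝ) (hη : ∀ i, η i ∈ Set.Icc (0 : ℝ) 1)
    (α : Fin n → ℝ) (hα : ∀ i, 0 ≤ α i) (hαsum : ∑ i, α i = 1)
    (hcomplete : ∑ i, (α i * η i) • v i = 0)
    (hs : 0 < ∑ j, α j * η j) :
    sInf {t : ℝ | ∃ (c : EuclideanSpace ℝ (Fin 3)) (c₀ : ℝ), ‖c‖ = 1 ∧
        c₀ ∈ Set.Icc (-1 : ℝ) 1 ∧
        t = ∑ i, α i * |c₀ + η i * ⟪c, v i⟫|} ≤
      sInf {t : ℝ | ∃ (c : EuclideanSpace ℝ (Fin 3)) (c₀ : ℝ), ‖c‖ = 1 ∧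
        c₀ ∈ Set.Icc (-1 : ℝ) 1 ∧
        t = ∑ i, (α i * η i / (∑ j, α j * η j)) * |c₀ + ⟪c, v i⟫|} := by
  refine le_csInf ⟨_, EuclideanSpace.single 0 1, 0, by simp, by simp, rfl⟩ ?_
  rintro t ⟨c, c₀, hc, hc₀, rfl⟩
  refine le_trans (csInf_le (a := ∑ i, α i * |c₀ + η i * ⟪c, v i⟫|) ⟨0, ?_⟩
    ⟨c, c₀, hc, hc₀, rfl⟩) ?_
  · rintro t ⟨c, c₀, -, -, rfl⟩
    exact Finset.sum_nonneg fun i _ => mul_nonneg (hα i) (abs_nonneg _)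
  have hmean : ∑ i, α i * η i * ⟪c, v i⟫ = 0 := by
    have h := congrArg (fun w => ⟪c, w⟫) hcomplete
    simpa [inner_sum, inner_smul_right] using h
  have hs1 : ∑ i, α i * η i ≤ 1 := by
    rw [← hαsum]
    exact Finset.sum_le_sum fun i _ => mul_le_of_le_one_right (hα i) (hη i).2
  have hE : ∑ i, (α i * η i / (∑ j, α j * η j)) * |c₀ + ⟪c, v i⟫|
      = (∑ i, α i * η i * |c₀ + ⟪c, v i⟫|) / (∑ j, α j * η j) := by
    rw [Finset.sum_div]
    exact Finset.sum_congr rfl fun i _ => by ring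
  have hA : (∑ i, α i * η i) * |c₀| ≤ ∑ i, α i * η i * |c₀ + ⟪c, v i⟫| := by
    have h1 : (∑ i, α i * η i) * c₀ = ∑ i, α i * η i * (c₀ + ⟪c, v i⟫) := by
      simp only [mul_add, Finset.sum_add_distrib, hmean, add_zero, Finset.sum_mul]
    rw [← abs_of_pos hs, ← abs_mul, h1]
    refine (Finset.abs_sum_le_sum_abs _ _).trans (Finset.sum_le_sum fun i _ => ?_)
    rw [abs_mul, abs_of_nonneg (mul_nonneg (hα i) (hη i).1)]
  have hB : ∑ i, α i * |c₀ + η i * ⟪c, v i⟫| ≤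
      ∑ i, α i * η i * |c₀ + ⟪c, v i⟫| + (1 - ∑ i, α i * η i) * |c₀| := by
    rw [← hαsum, ← Finset.sum_sub_distrib, Finset.sum_mul, ← Finset.sum_add_distrib]
    refine Finset.sum_le_sum fun i _ => ?_
    have h2 : |c₀ + η i * ⟪c, v i⟫| ≤ η i * |c₀ + ⟪c, v i⟫| + (1 - η i) * |c₀| := by
      have h3 : c₀ + η i * ⟪c, v i⟫ = η i * (c₀ + ⟪c, v i⟫) + (1 - η i) * c₀ := by ring
      rw [h3]
      refine (abs_add_le _ _).trans ?_
      rw [abs_mul, abs_mul, abs_of_nonneg (hη i).1, abs_of_nonneg (sub_nonneg.2 (hη i).2)]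
    nlinarith [mul_le_mul_of_nonneg_left h2 (hα i)]
  rw [hE]
  refine hB.trans ?_
  rw [le_div_iff₀ hs]
  nlinarith [mul_le_mul_of_nonneg_left hA (sub_nonneg.2 hs1)]
end
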